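/- arXiv:1004.2723 — 14 statements merged into one kernel-verified Lean document; each statement's English description precedes it below -/
import Mathlib

section
/- Let d ≥ 1 and ℓ ≥ 1 be integers and let v_1, …, v_ℓ be vectors in ℤ^d. Then there exists a constant C > 0 (depending only on v_1, …, v_ℓ) such that for every integer N ≥ 1 and every set A ⊆ [1,N]^d with |A|/N^d ≥ C · N^(−1/ℓ), there exists an integer r > 0 such that r·v_j ∈ A − A for every 1 ≤ j ≤ ℓ. -/
/-- Theorem 1.1 (Hamel–Lyall–Thompson–Walters): given vectors `v 1, …, v ℓ` in `ℤ^d`,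
there is a constant `C > 0` such that any `A ⊆ [1,N]^d` with `|A|/N^d ≥ C·N^(-1/ℓ)`
has `{r v_1, …, r v_ℓ} ⊆ A - A` for some integer `r > 0`. -/
theorem sparse_difference_sets_dilate
    (d ℓ : ℕ) (hd : 1 ≤ d) (hℓ : 1 ≤ ℓ) (v : Fin ℓ → (Fin d → ℤ)) :
    ∃ C : ℝ, 0 < C ∧
      ∀ N : ℕ, 1 ≤ N → ∀ A : Finset (Fin d → ℤ),
        (∀ x ∈ A, ∀ i : Fin d, x i ∈ Finset.Icc (1 : ℤ) (N : ℤ)) →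
        C * (N : ℝ) ^ (-(1 / (ℓ : ℝ))) ≤ (A.card : ℝ) / (N : ℝ) ^ d →
        ∃ r : ℤ, 0 < r ∧ ∀ j : Fin ℓ, ∃ a ∈ A, ∃ a' ∈ A, a - a' = r • v j := by
  obtain ⟨V, hV⟩ : ∃ V : ℕ, ∀ j i, |v j i| ≤ (V : ℤ) := by
    refine ⟨∑ j, ∑ i, (v j i).natAbs, fun j i => ?_⟩
    have h1 : (v j i).natAbs ≤ ∑ i, (v j i).natAbs :=
      Finset.single_le_sum (f := fun i => (v j i).natAbs) (fun _ _ => Nat.zero_le _)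
        (Finset.mem_univ i)
    have h2 : ∑ i, (v j i).natAbs ≤ ∑ j, ∑ i, (v j i).natAbs :=
      Finset.single_le_sum (f := fun j => ∑ i, (v j i).natAbs) (fun _ _ => Nat.zero_le _)
        (Finset.mem_univ j)
    have h3 := h1.trans h2
    rw [Int.abs_eq_natAbs]
    exact_mod_cast h3
  refine ⟨(2 * V + 1 : ℝ) ^ d + 1, by positivity, ?_⟩
  intro N hN A hA hcard
  have hNpos : (0 : ℝ) < N := by exact_mod_cast hN
  set s := (Finset.Icc (1 : ℤ) N) ×ˢ (Fintype.piFinset fun _ : Fin ℓ => A) with hs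
  set t := Fintype.piFinset (fun _ : Fin ℓ => Fintype.piFinset fun _ : Fin d =>
    Finset.Icc (1 - (N * V : ℤ)) (N + N * V)) with ht
  have hsc : s.card = N * A.card ^ ℓ := by
    simp [hs, Finset.card_product, Fintype.card_piFinset]
  have htc : t.card = (((2 * V + 1) * N) ^ d) ^ ℓ := by
    have : ((N : ℤ) + N * V + 1 - (1 - N * V)).toNat = (2 * V + 1) * N := by
      have : ((N : ℤ) + N * V + 1 - (1 - N * V)) = (((2 * V + 1) * N : ℕ) : ℤ) := by
        push_cast; ring
      rw [this, Int.toNat_natCast]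
    simp [ht, Fintype.card_piFinset, this]
  have hlt : t.card < s.card := by
    have h1 : ((2 * V + 1 : ℝ) ^ d + 1) * (N : ℝ) ^ (-(1 / (ℓ : ℝ))) * (N : ℝ) ^ d ≤ A.card := by
      rwa [le_div_iff₀ (by positivity)] at hcard
    have h2 := pow_le_pow_left₀ (by positivity) h1 ℓ
    have h3 : ((N : ℝ) ^ (-(1 / (ℓ : ℝ)))) ^ ℓ = (N : ℝ)⁻¹ := by
      rw [← Real.rpow_natCast, ← Real.rpow_mul hNpos.le]
      have : (ℓ : ℝ) ≠ 0 := by positivity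
      rw [show -(1 / (ℓ : ℝ)) * ℓ = -1 by field_simp, Real.rpow_neg_one]
    rw [mul_pow, mul_pow, h3] at h2
    have h4 : ((2 * V + 1 : ℝ) ^ d) ^ ℓ < ((2 * V + 1 : ℝ) ^ d + 1) ^ ℓ :=
      pow_lt_pow_left₀ (by linarith) (by positivity) (by omega)
    have h5 : ((2 * V + 1 : ℝ) ^ d + 1) ^ ℓ * ((N : ℝ) ^ d) ^ ℓ ≤ N * (A.card : ℝ) ^ ℓ := by
      have := mul_le_mul_of_nonneg_left h2 hNpos.le
      refine le_trans (le_of_eq ?_) this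
      field_simp
    have h6 : ((2 * V + 1 : ℝ) ^ d) ^ ℓ * ((N : ℝ) ^ d) ^ ℓ
        < ((2 * V + 1 : ℝ) ^ d + 1) ^ ℓ * ((N : ℝ) ^ d) ^ ℓ :=
      mul_lt_mul_of_pos_right h4 (by positivity)
    have h7 := h6.trans_le h5
    rw [← mul_pow, ← mul_pow] at h7
    rw [hsc, htc]
    exact_mod_cast h7
  have hmaps : ∀ p ∈ s, (fun j i => p.2 j i + p.1 * v j i) ∈ t := by
    rintro ⟨r, a⟩ hp
    simp only [hs, Finset.mem_product, Fintype.mem_piFinset, Finset.mem_Icc] at hp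
    simp only [ht, Fintype.mem_piFinset, Finset.mem_Icc]
    intro j i
    have h1 := hA _ (hp.2 j) i
    rw [Finset.mem_Icc] at h1
    have h2 : |r * v j i| ≤ N * V := by
      rw [abs_mul]
      exact mul_le_mul (by rw [abs_of_nonneg] <;> omega) (hV j i) (abs_nonneg _) (by positivity)
    rw [abs_le] at h2
    constructor <;> linarith [h1.1, h1.2, h2.1, h2.2]
  obtain ⟨p, hp, q, hq, hne, heq⟩ := Finset.exists_ne_map_eq_of_card_lt_of_maps_to hlt hmaps
  have heq' : ∀ j i, p.2 j i + p.1 * v j i = q.2 j i + q.1 * v j i := fun j i =>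
    congrFun (congrFun heq j) i
  simp only [hs, Finset.mem_product, Fintype.mem_piFinset] at hp hq
  rcases lt_trichotomy p.1 q.1 with h | h | h
  · refine ⟨q.1 - p.1, by omega, fun j => ⟨p.2 j, hp.2 j, q.2 j, hq.2 j, ?_⟩⟩
    ext i
    simp only [Pi.sub_apply, Pi.smul_apply, smul_eq_mul]
    linarith [heq' j i]
  · exfalso
    apply hne
    refine Prod.ext h ?_
    funext j i
    have := heq' j i
    rw [h] at this
    linarith
  · refine ⟨p.1 - q.1, by omega, fun j => ⟨q.2 j, hq.2 j, p.2 j, hp.2 j, ?_⟩⟩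
    ext i
    simp only [Pi.sub_apply, Pi.smul_apply, smul_eq_mul]
    linarith [heq' j i]
end

section
/- Let d ≥ 1 and ℓ ≥ 1 be integers, let v_1, …, v_ℓ be vectors in ℤ^d, not all zero, and set s = max over 1 ≤ j ≤ ℓ and 1 ≤ i ≤ d of |⟨v_j, e_i⟩| (the maximum absolute value of a coordinate of the v_j). If N ≥ 1 is an integer and A ⊆ [1,N]^d satisfies (|A|/N^d)^ℓ ≥ (2s/N) · ∏_{i=1}^d ∏_{j=1}^ℓ (1 + |⟨v_j, e_i⟩|/s), then there exists an integer r > 0 such that r·v_j ∈ A − A for every 1 ≤ j ≤ ℓ. -/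
lemma aux_card (N : ℕ) (c : ℤ) :
    (((Finset.Icc (1:ℤ) N).filter (fun y => y - c ∉ Finset.Icc (1:ℤ) N)).card : ℤ) ≤ |c| := by
  rcases le_total 0 c with h | h
  · have : ((Finset.Icc (1:ℤ) N).filter (fun y => y - c ∉ Finset.Icc (1:ℤ) N)) ⊆ Finset.Icc 1 c := by
      intro y hy
      simp only [Finset.mem_filter, Finset.mem_Icc] at hy ⊢
      omega
    have h2 := Finset.card_le_card this
    rw [Int.card_Icc] at h2
    rw [abs_of_nonneg h]
    omega
  · have : ((Finset.Icc (1:ℤ) N).filter (fun y => y - c ∉ Finset.Icc (1:ℤ) N))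
        ⊆ Finset.Icc (N + 1 + c) N := by
      intro y hy
      simp only [Finset.mem_filter, Finset.mem_Icc] at hy ⊢
      omega
    have h2 := Finset.card_le_card this
    rw [Int.card_Icc] at h2
    rw [abs_of_nonpos h]
    omega

lemma aux_slab {ι : Type*} [Fintype ι] [DecidableEq ι] (N : ℕ) (V : ι → ℤ) (k : ι) :
    (N : ℤ) * (((Fintype.piFinset (fun _ : ι => Finset.Icc (1:ℤ) N)).filter
      (fun x => x k - V k ∉ Finset.Icc (1:ℤ) N)).card : ℤ) ≤ |V k| * (N:ℤ) ^ Fintype.card ι := by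
  set F := (Finset.Icc (1:ℤ) N).filter (fun y => y - V k ∉ Finset.Icc (1:ℤ) N) with hF
  have hsub : ((Fintype.piFinset (fun _ : ι => Finset.Icc (1:ℤ) N)).filter
      (fun x => x k - V k ∉ Finset.Icc (1:ℤ) N)) ⊆
      Fintype.piFinset (Function.update (fun _ : ι => Finset.Icc (1:ℤ) N) k F) := by
    intro x hx
    rw [Finset.mem_filter, Fintype.mem_piFinset] at hx
    rw [Fintype.mem_piFinset]
    intro a
    by_cases h : a = k
    · subst h
      rw [Function.update_self, hF, Finset.mem_filter]
      exact ⟨hx.1 a, hx.2⟩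
    · rw [Function.update_of_ne h]
      exact hx.1 a
  have hc := Finset.card_le_card hsub
  rw [Fintype.card_piFinset, ← Finset.mul_prod_erase Finset.univ _ (Finset.mem_univ k),
    Function.update_self] at hc
  have hp : ∏ x ∈ Finset.univ.erase k,
      (Function.update (fun _ : ι => Finset.Icc (1:ℤ) N) k F x).card
      = N ^ (Fintype.card ι - 1) := by
    rw [Finset.prod_congr rfl (g := fun _ => N)]
    · rw [Finset.prod_const, Finset.card_erase_of_mem (Finset.mem_univ k), Finset.card_univ]
    · intro x hx
      rw [Function.update_of_ne (Finset.ne_of_mem_erase hx), Int.card_Icc]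
      omega
  rw [hp] at hc
  have hF2 := aux_card N (V k)
  rw [← hF] at hF2
  have hpos : 0 < Fintype.card ι := Fintype.card_pos_iff.mpr ⟨k⟩
  have hpow : (N:ℤ) ^ Fintype.card ι = N * (N:ℤ) ^ (Fintype.card ι - 1) := by
    rw [← pow_succ']; congr 1; omega
  have hc' : ((((Fintype.piFinset (fun _ : ι => Finset.Icc (1:ℤ) N)).filter
      (fun x => x k - V k ∉ Finset.Icc (1:ℤ) N)).card : ℕ) : ℤ)
      ≤ (F.card : ℤ) * (N:ℤ) ^ (Fintype.card ι - 1) := by exact_mod_cast hc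
  calc _ ≤ (N:ℤ) * ((F.card : ℤ) * (N:ℤ) ^ (Fintype.card ι - 1)) := by gcongr
    _ ≤ (N:ℤ) * (|V k| * (N:ℤ) ^ (Fintype.card ι - 1)) := by gcongr
    _ = _ := by rw [hpow]; ring

lemma aux_main {ι : Type*} [Fintype ι] [DecidableEq ι] (N : ℕ) (V : ι → ℤ) (k₀ : ι)
    (hV : V k₀ ≠ 0) (B : Finset (ι → ℤ))
    (hB : B ⊆ Fintype.piFinset (fun _ : ι => Finset.Icc (1:ℤ) N))
    (hcard : (∑ k, |V k|) * (N:ℤ) ^ Fintype.card ι < N * (B.card : ℤ)) :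
    ∃ r : ℤ, 0 < r ∧ ∃ b ∈ B, ∃ b' ∈ B, b - b' = r • V := by
  set X := Fintype.piFinset (fun _ : ι => Finset.Icc (1:ℤ) N) with hX
  set E := Finset.univ.biUnion (fun k : ι => X.filter
      (fun x => x k - V k ∉ Finset.Icc (1:ℤ) N)) with hE
  have hEc : (N:ℤ) * (E.card : ℤ) ≤ (∑ k, |V k|) * (N:ℤ) ^ Fintype.card ι := by
    have h1 : (E.card : ℤ) ≤ ∑ k : ι, ((X.filter
      (fun x => x k - V k ∉ Finset.Icc (1:ℤ) N)).card : ℤ) := by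
      exact_mod_cast Finset.card_biUnion_le
    calc _ ≤ (N:ℤ) * ∑ k : ι, ((X.filter
      (fun x => x k - V k ∉ Finset.Icc (1:ℤ) N)).card : ℤ) := by gcongr
      _ ≤ _ := by
        rw [Finset.mul_sum, Finset.sum_mul]
        exact Finset.sum_le_sum fun k _ => aux_slab N V k
  have hlt : E.card < B.card := by
    have : (N:ℤ) * (E.card : ℤ) < N * (B.card : ℤ) := lt_of_le_of_lt hEc hcard
    exact_mod_cast lt_of_mul_lt_mul_left this (by positivity)
  have hex : ∀ b ∈ B, ∃ n : ℕ, b - (n:ℤ) • V ∈ E := by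
    intro b hb
    have hbX := hB hb
    have hout : ∃ n : ℕ, b - (n:ℤ) • V ∉ X := by
      refine ⟨N, fun h => ?_⟩
      rw [hX, Fintype.mem_piFinset] at h hbX
      have h1 := h k₀
      have h2 := hbX k₀
      simp only [Finset.mem_Icc, Pi.sub_apply, Pi.smul_apply, smul_eq_mul] at h1 h2
      rcases lt_or_gt_of_ne hV with h3 | h3
      · nlinarith
      · nlinarith
    classical
    obtain ⟨m, hm⟩ : ∃ m, Nat.find hout = m + 1 := by
      refine Nat.exists_eq_succ_of_ne_zero fun h0 => ?_
      have := Nat.find_spec hout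
      rw [h0] at this
      simp [hbX] at this
    have hmem : b - (m:ℤ) • V ∈ X := by
      by_contra hcon
      exact Nat.find_min hout (by omega) hcon
    have hnot := Nat.find_spec hout
    rw [hm] at hnot
    refine ⟨m, ?_⟩
    have : ∃ k, (b - ((m + 1 : ℕ):ℤ) • V) k ∉ Finset.Icc (1:ℤ) N := by
      by_contra! hcon
      exact hnot (by rw [hX, Fintype.mem_piFinset]; exact hcon)
    obtain ⟨k, hk⟩ := this
    rw [hE, Finset.mem_biUnion]
    refine ⟨k, Finset.mem_univ _, Finset.mem_filter.mpr ⟨hmem, ?_⟩⟩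
    convert hk using 1
    simp only [Pi.sub_apply, Pi.smul_apply, smul_eq_mul]
    push_cast
    ring_nf
  choose! n hn using hex
  obtain ⟨b, hb, b', hb', hne, heq⟩ :=
    Finset.exists_ne_map_eq_of_card_lt_of_maps_to hlt (f := fun b => b - (n b:ℤ) • V) hn
  have hd : b - b' = ((n b : ℤ) - n b') • V := by
    rw [sub_smul]
    have : b - (n b:ℤ) • V = b' - (n b':ℤ) • V := heq
    rw [sub_eq_sub_iff_add_eq_add] at this ⊢
    rw [this]; abel
  rcases lt_trichotomy ((n b : ℤ) - n b') 0 with h | h | h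
  · refine ⟨-((n b : ℤ) - n b'), by omega, b', hb', b, hb, ?_⟩
    rw [neg_smul, ← hd]; abel
  · rw [h, zero_smul, sub_eq_zero] at hd
    exact absurd hd hne
  · exact ⟨_, h, b, hb, b', hb', hd⟩

lemma aux_prod {ι : Type*} (S : Finset ι) (t : ι → ℝ) (ht : ∀ i, 0 ≤ t i) :
    1 + ∑ i ∈ S, t i ≤ ∏ i ∈ S, (1 + t i) := by
  classical
  induction S using Finset.induction_on with
  | empty => simp
  | insert a S ha ih =>
    rw [Finset.sum_insert ha, Finset.prod_insert ha]
    have h1 : 0 ≤ ∑ i ∈ S, t i := Finset.sum_nonneg fun i _ => ht i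
    nlinarith [ht a, mul_nonneg (ht a) h1, mul_le_mul_of_nonneg_left ih (ht a)]

/-- Theorem 1.1 with the explicit constant: if `s` is the maximal absolute value of a
coordinate of the `v j` (not all zero) and
`(|A|/N^d)^ℓ ≥ (2s/N)·∏_{i,j} (1 + |⟨v_j,e_i⟩|/s)`, then `A - A` contains a dilate
`{r v_1, …, r v_ℓ}` with `r > 0`. -/
theorem sparse_difference_sets_dilate_explicit
    (d ℓ : ℕ) (hd : 1 ≤ d) (hℓ : 1 ≤ ℓ) (v : Fin ℓ → (Fin d → ℤ))
    (hv : ∃ j i, v j i ≠ 0)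
    (s : ℤ) (hs_ub : ∀ j i, |v j i| ≤ s) (hs_mem : ∃ j i, |v j i| = s)
    (N : ℕ) (hN : 1 ≤ N) (A : Finset (Fin d → ℤ))
    (hA : ∀ x ∈ A, ∀ i : Fin d, x i ∈ Finset.Icc (1 : ℤ) (N : ℤ))
    (hdens : (2 * (s : ℝ) / N) * ∏ i : Fin d, ∏ j : Fin ℓ, (1 + |(v j i : ℝ)| / s)
        ≤ ((A.card : ℝ) / (N : ℝ) ^ d) ^ ℓ) :
    ∃ r : ℤ, 0 < r ∧ ∀ j : Fin ℓ, ∃ a ∈ A, ∃ a' ∈ A, a - a' = r • v j := by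
  obtain ⟨j₀, i₀, hv0⟩ := hv
  have hs : 0 < s := lt_of_lt_of_le (abs_pos.mpr hv0) (hs_ub j₀ i₀)
  have hsR : (0:ℝ) < s := by exact_mod_cast hs
  have hNR : (0:ℝ) < N := by exact_mod_cast hN
  set V : Fin ℓ × Fin d → ℤ := fun p => v p.1 p.2 with hVdef
  set C := Fintype.piFinset (fun _ : Fin ℓ => A) with hC
  have hinj : Function.Injective
      (fun (x : Fin ℓ → Fin d → ℤ) (p : Fin ℓ × Fin d) => x p.1 p.2) := by
    intro x y h
    funext j i
    exact congrFun h (j, i)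
  set B := C.image (fun (x : Fin ℓ → Fin d → ℤ) (p : Fin ℓ × Fin d) => x p.1 p.2) with hBdef
  have hBc : B.card = A.card ^ ℓ := by
    rw [hBdef, Finset.card_image_of_injective _ hinj, hC, Fintype.card_piFinset]
    simp
  have hB : B ⊆ Fintype.piFinset (fun _ : Fin ℓ × Fin d => Finset.Icc (1:ℤ) N) := by
    intro b hb
    obtain ⟨x, hx, rfl⟩ := Finset.mem_image.mp hb
    rw [Fintype.mem_piFinset] at hx ⊢
    exact fun p => hA _ (hx p.1) p.2
  have hcard : (∑ k, |V k|) * (N:ℤ) ^ Fintype.card (Fin ℓ × Fin d) < N * (B.card : ℤ) := by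
    have hP := aux_prod (Finset.univ : Finset (Fin ℓ × Fin d)) (fun p => |(V p : ℝ)| / s)
      (fun p => by positivity)
    have hPe : ∏ p : Fin ℓ × Fin d, (1 + |(V p : ℝ)| / s)
        = ∏ i : Fin d, ∏ j : Fin ℓ, (1 + |(v j i : ℝ)| / s) := by
      rw [Fintype.prod_prod_type_right]
    rw [hPe, ← Finset.sum_div] at hP
    set P := ∏ i : Fin d, ∏ j : Fin ℓ, (1 + |(v j i : ℝ)| / s) with hPdef
    set T := ∑ p : Fin ℓ × Fin d, |(V p : ℝ)| with hT
    have hT0 : 0 ≤ T := Finset.sum_nonneg fun _ _ => abs_nonneg _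
    have h1 : (s:ℝ) + T ≤ s * P := by
      have := mul_le_mul_of_nonneg_left hP hsR.le
      rw [mul_add, mul_one, mul_div_cancel₀ _ hsR.ne'] at this
      exact this
    have h2 : 2 * s * P * (N:ℝ) ^ (ℓ * d) ≤ N * (A.card:ℝ) ^ ℓ := by
      rw [div_pow, ← pow_mul, mul_comm d ℓ, le_div_iff₀ (by positivity)] at hdens
      have := mul_le_mul_of_nonneg_left hdens hNR.le
      calc _ = (N:ℝ) * (2 * s / N * P * N ^ (ℓ * d)) := by field_simp
        _ ≤ _ := this
    have h3 : T * (N:ℝ) ^ (ℓ * d) < N * (A.card:ℝ) ^ ℓ := by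
      refine lt_of_lt_of_le ?_ h2
      have : (0:ℝ) < (N:ℝ) ^ (ℓ * d) := by positivity
      apply mul_lt_mul_of_pos_right _ this
      linarith
    rw [hBc, Fintype.card_prod, Fintype.card_fin, Fintype.card_fin]
    have : (((∑ k, |V k|) * (N:ℤ) ^ (ℓ * d) : ℤ) : ℝ) < ((N * ((A.card ^ ℓ : ℕ) : ℤ) : ℤ) : ℝ) := by
      push_cast
      exact h3
    exact_mod_cast this
  obtain ⟨r, hr, b, hb, b', hb', h⟩ := aux_main N V (j₀, i₀) hv0 B hB hcard
  obtain ⟨x, hx, rfl⟩ := Finset.mem_image.mp hb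
  obtain ⟨y, hy, rfl⟩ := Finset.mem_image.mp hb'
  rw [Fintype.mem_piFinset] at hx hy
  refine ⟨r, hr, fun j => ⟨x j, hx j, y j, hy j, ?_⟩⟩
  funext i
  exact congrFun h (j, i)
end

section
/- Let d ≥ 1 be an integer and let e_1, …, e_d denote the standard basis vectors of ℤ^d. If N ≥ 1 is an integer and A ⊆ [1,N]^d satisfies |A|/N^d ≥ 2^(1 + 1/d) · N^(−1/d), then there exists an integer r > 0 such that r·e_i ∈ A − A for every 1 ≤ i ≤ d (i.e., A − A contains a dilated d-dimensional corner). -/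
theorem corner_aux_real (n N : ℕ) (hN : 1 ≤ N) (c : ℕ)
    (h : (2 : ℝ) ^ (1 + 1 / ((n + 1 : ℕ) : ℝ)) * (N : ℝ) ^ (-(1 / ((n + 1 : ℕ) : ℝ)))
        ≤ (c : ℝ) / (N : ℝ) ^ (n + 1)) :
    N ^ n * (2 * N * N ^ n) ^ n < c ^ (n + 1) := by
  have hNp : (0 : ℝ) < N := by exact_mod_cast hN
  have hd : ((n + 1 : ℕ) : ℝ) ≠ 0 := by positivity
  rw [le_div_iff₀ (by positivity)] at h
  have h2 := pow_le_pow_left₀ (by positivity) h (n + 1)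
  rw [mul_pow, mul_pow, ← Real.rpow_natCast ((2 : ℝ) ^ _) (n + 1), ← Real.rpow_mul (by norm_num),
    ← Real.rpow_natCast ((N : ℝ) ^ (-_ : ℝ)) (n + 1), ← Real.rpow_mul hNp.le] at h2
  have e1 : (1 + 1 / ((n + 1 : ℕ) : ℝ)) * ((n + 1 : ℕ) : ℝ) = ((n + 2 : ℕ) : ℝ) := by
    field_simp; push_cast; ring
  have e2 : (-(1 / ((n + 1 : ℕ) : ℝ))) * ((n + 1 : ℕ) : ℝ) = -1 := by
    field_simp
  rw [e1, e2, Real.rpow_natCast, Real.rpow_neg_one] at h2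
  have h3 : (2 : ℝ) ^ (n + 2) * (N ^ n * (N * N ^ n) ^ n) ≤ (c : ℝ) ^ (n + 1) := by
    refine le_trans (le_of_eq ?_) h2
    rw [pow_succ ((N : ℝ) ^ (n + 1)) n, pow_succ (N : ℝ) n, mul_comm (N : ℝ) ((N : ℝ) ^ n)]
    field_simp
  have h4 : 2 ^ (n + 2) * (N ^ n * (N * N ^ n) ^ n) ≤ c ^ (n + 1) := by exact_mod_cast h3
  refine lt_of_lt_of_le ?_ h4
  have : N ^ n * (2 * N * N ^ n) ^ n = 2 ^ n * (N ^ n * (N * N ^ n) ^ n) := by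
    rw [mul_assoc 2, mul_pow 2]; ring
  rw [this]
  have hp : 0 < N ^ n * (N * N ^ n) ^ n := by positivity
  exact Nat.mul_lt_mul_of_pos_right (Nat.pow_lt_pow_right (by norm_num) (by omega)) hp

/-- Corners: if `A ⊆ [1,N]^d` with `|A|/N^d ≥ 2^(1+1/d)·N^(-1/d)`, then `A - A`
contains a dilated `d`-dimensional corner `{r e_1, …, r e_d}` with `r > 0`. -/
theorem sparse_difference_sets_corner
    (d : ℕ) (hd : 1 ≤ d) (N : ℕ) (hN : 1 ≤ N) (A : Finset (Fin d → ℤ))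
    (hA : ∀ x ∈ A, ∀ i : Fin d, x i ∈ Finset.Icc (1 : ℤ) (N : ℤ))
    (hdens : (2 : ℝ) ^ (1 + 1 / (d : ℝ)) * (N : ℝ) ^ (-(1 / (d : ℝ)))
        ≤ (A.card : ℝ) / (N : ℝ) ^ d) :
    ∃ r : ℤ, 0 < r ∧ ∀ i : Fin d, ∃ a ∈ A, ∃ a' ∈ A, a - a' = r • Pi.single i (1 : ℤ) := by
  obtain ⟨n, rfl⟩ : ∃ n, d = n + 1 := ⟨d - 1, by omega⟩
  have key := corner_aux_real n N hN A.card hdens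
  let D : Fin (n + 1) → Finset ℤ := fun i =>
    if i = 0 then {0} else Finset.Ioc (-(N : ℤ)) (N : ℤ)
  let T : Fin (n + 1) → Fin (n + 1) → Finset ℤ := fun i j =>
    if j = i then D i else Finset.Icc (1 : ℤ) (N : ℤ)
  let S : Finset (Fin (n + 1) → Fin (n + 1) → ℤ) :=
    Fintype.piFinset fun i => Fintype.piFinset (T i)
  let P : Finset (Fin (n + 1) → Fin (n + 1) → ℤ) := Fintype.piFinset fun _ => A
  let F : (Fin (n + 1) → Fin (n + 1) → ℤ) → (Fin (n + 1) → Fin (n + 1) → ℤ) :=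
    fun f i j => if j = i then f i i - f 0 0 else f i j
  have hrow : ∀ i, ∏ j, (T i j).card = (D i).card * N ^ n := by
    intro i
    rw [← Finset.mul_prod_erase Finset.univ _ (Finset.mem_univ i)]
    congr 1
    · simp [T]
    · rw [Finset.prod_congr rfl (g := fun _ => N)]
      · simp
      · intro j hj
        have := Finset.ne_of_mem_erase hj
        simp [T, this]
  have hS : S.card = N ^ n * (2 * N * N ^ n) ^ n := by
    simp only [S, Fintype.card_piFinset, hrow]
    rw [Fin.prod_univ_succ]
    have : ∀ i : Fin n, (D i.succ).card = 2 * N := by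
      intro i
      simp [D, Fin.succ_ne_zero]
      omega
    simp only [this]
    simp [D]
  have hP : P.card = A.card ^ (n + 1) := by simp [P]
  have hmaps : ∀ f ∈ P, F f ∈ S := by
    intro f hf
    have hf' : ∀ i, f i ∈ A := by simpa [P] using hf
    simp only [S, Fintype.mem_piFinset]
    intro i j
    by_cases hij : j = i
    · subst hij
      by_cases h0 : j = 0
      · subst h0; simp [F, T, D]
      · have h1 := Finset.mem_Icc.1 (hA _ (hf' j) j)
        have h2 := Finset.mem_Icc.1 (hA _ (hf' 0) 0)
        simp only [F, T, D, h0, if_true, if_false, Finset.mem_Ioc]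
        omega
    · simpa [F, T, hij] using hA _ (hf' i) j
  obtain ⟨f, hf, g, hg, hne, hfg⟩ :=
    Finset.exists_ne_map_eq_of_card_lt_of_maps_to (by rw [hS, hP]; exact key) hmaps
  have main : ∀ f ∈ P, ∀ g ∈ P, F f = F g → 0 < f 0 0 - g 0 0 →
      ∃ r : ℤ, 0 < r ∧ ∀ i : Fin (n + 1), ∃ a ∈ A, ∃ a' ∈ A,
        a - a' = r • Pi.single i (1 : ℤ) := by
    intro f hf g hg hfg hpos
    refine ⟨_, hpos, fun i => ⟨f i, ?_, g i, ?_, ?_⟩⟩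
    · exact (Fintype.mem_piFinset.1 hf) i
    · exact (Fintype.mem_piFinset.1 hg) i
    · ext j
      have := congrFun (congrFun hfg i) j
      by_cases hij : j = i
      · subst hij
        simp [F] at this
        simp
        omega
      · simp [F, hij] at this
        simp [hij, this]
  rcases lt_trichotomy (f 0 0) (g 0 0) with h | h | h
  · exact main g hg f hf hfg.symm (by omega)
  · exfalso
    apply hne
    ext i j
    have := congrFun (congrFun hfg i) j
    by_cases hij : j = i
    · subst hij
      simp [F] at this
      omega
    · simpa [F, hij] using this
  · exact main f hf g hg hfg (by omega)
end

section
/- Let d ≥ 1 and ℓ ≥ 1 be integers and let v_1, …, v_ℓ be vectors in ℤ^d. Then there exists a constant C > 0 (depending only on v_1, …, v_ℓ) such that for every integer N ≥ 1 and all sets A, B ⊆ [1,N]^d with |A||B|/N^(2d) ≥ 2^d · C · N^(−1/ℓ), there exist an integer r ≠ 0 and a point t ∈ [2,2N]^d such that t + r·v_j ∈ A + B and t − r·v_j ∈ A + B for every 1 ≤ j ≤ ℓ. -/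
/-- A dense subset of `[1,N]^d` contains all the dilates `R • v j` in its difference set. -/
theorem dilate_aux (d ℓ : ℕ) (hℓ : 1 ≤ ℓ) (v : Fin ℓ → (Fin d → ℤ)) (M : ℕ)
    (hM : ∀ j i, |v j i| ≤ (M : ℤ)) (N : ℕ) (hN : 1 ≤ N) (S : Finset (Fin d → ℤ))
    (hS : ∀ x ∈ S, ∀ i : Fin d, x i ∈ Finset.Icc (1 : ℤ) (N : ℤ))
    (hc : (2 * (2 * (M : ℝ) + 1) ^ d) * (N : ℝ) ^ d * (N : ℝ) ^ (-(1 / (ℓ : ℝ))) ≤ S.card) :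
    ∃ R : ℤ, R ≠ 0 ∧ ∀ j, ∃ x ∈ S, ∃ y ∈ S, R • v j = y - x := by
  classical
  have hNR : (0 : ℝ) < N := by exact_mod_cast hN
  have hl0 : (ℓ : ℝ) ≠ 0 := by
    have : ℓ ≠ 0 := by omega
    exact_mod_cast this
  set T : Finset (Fin ℓ → Fin d → ℤ) := Fintype.piFinset fun _ => Fintype.piFinset fun _ =>
    Finset.Icc (1 - (M : ℤ) * N) (N + M * N) with hT
  set D : Finset ((Fin ℓ → Fin d → ℤ) × ℤ) :=
    (Fintype.piFinset fun _ : Fin ℓ => S) ×ˢ Finset.Icc (1 : ℤ) N with hD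
  have hTc : T.card = ((N * (2 * M + 1)) ^ d) ^ ℓ := by
    have : ((N : ℤ) + M * N + 1 - (1 - M * N)).toNat = N * (2 * M + 1) := by
      have : ((N : ℤ) + M * N + 1 - (1 - M * N)) = ((N * (2 * M + 1) : ℕ) : ℤ) := by
        push_cast; ring
      rw [this, Int.toNat_natCast]
    simp [hT, Fintype.card_piFinset, this]
  have hDc : D.card = S.card ^ ℓ * N := by
    simp [hD, Fintype.card_piFinset]
  have hlt : T.card < D.card := by
    have h1 : ((2 * (2 * (M : ℝ) + 1) ^ d) * (N : ℝ) ^ d * (N : ℝ) ^ (-(1 / (ℓ : ℝ)))) ^ ℓ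
        ≤ (S.card : ℝ) ^ ℓ := by
      apply pow_le_pow_left₀ _ hc
      positivity
    have h2 : ((N : ℝ) ^ (-(1 / (ℓ : ℝ)))) ^ ℓ * N = 1 := by
      rw [← Real.rpow_natCast, ← Real.rpow_mul hNR.le]
      have : -(1 / (ℓ : ℝ)) * ℓ = -1 := by field_simp
      rw [this, Real.rpow_neg_one]
      field_simp
    have h3 : (((N * (2 * M + 1)) ^ d) ^ ℓ : ℝ) < (S.card : ℝ) ^ ℓ * N := by
      calc (((N * (2 * M + 1)) ^ d) ^ ℓ : ℝ)
          < 2 ^ ℓ * (((N * (2 * M + 1)) ^ d) ^ ℓ : ℝ) := by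
            have : (1 : ℝ) < 2 ^ ℓ := one_lt_pow₀ (by norm_num) (by omega)
            have h : (0 : ℝ) < (((N * (2 * M + 1)) ^ d) ^ ℓ : ℝ) := by positivity
            nlinarith
        _ = 2 ^ ℓ * (((N * (2 * M + 1)) ^ d) ^ ℓ : ℝ) *
              (((N : ℝ) ^ (-(1 / (ℓ : ℝ)))) ^ ℓ * N) := by rw [h2, mul_one]
        _ = ((2 * (2 * (M : ℝ) + 1) ^ d) * (N : ℝ) ^ d *
              (N : ℝ) ^ (-(1 / (ℓ : ℝ)))) ^ ℓ * N := by
            simp only [mul_pow]; ring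
        _ ≤ _ := by gcongr
    rw [hTc, hDc]
    exact_mod_cast h3
  obtain ⟨p, hp, q, hq, hne, heq⟩ := Finset.exists_ne_map_eq_of_card_lt_of_maps_to hlt
    (f := fun p => fun j => p.1 j + p.2 • v j) (by
      intro p hp
      have hp' : p ∈ D := hp
      simp only [hD, Finset.mem_product, Fintype.mem_piFinset, Finset.mem_Icc] at hp'
      obtain ⟨hp1, hp2, hp3⟩ := hp'
      show _ ∈ T
      simp only [hT, Fintype.mem_piFinset, Finset.mem_Icc]
      intro j i
      have a := hS _ (hp1 j) i
      rw [Finset.mem_Icc] at a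
      have b : |p.2 * v j i| ≤ N * M := by
        rw [abs_mul]
        apply mul_le_mul _ (hM j i) (abs_nonneg _) (by positivity)
        rw [abs_le]; constructor <;> linarith
      rw [abs_le] at b
      simp only [Pi.add_apply, Pi.smul_apply, smul_eq_mul]
      constructor <;> nlinarith)
  simp only [hD, Finset.mem_product, Fintype.mem_piFinset] at hp hq
  have hj : ∀ j, (p.2 - q.2) • v j = q.1 j - p.1 j := by
    intro j
    have := congrFun heq j
    rw [sub_smul, sub_eq_sub_iff_add_eq_add, add_comm, this]
  refine ⟨p.2 - q.2, ?_, fun j => ⟨p.1 j, hp.1 j, q.1 j, hq.1 j, hj j⟩⟩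
  intro h0
  apply hne
  refine Prod.ext (funext fun j => ?_) (sub_eq_zero.mp h0)
  have := hj j
  rw [h0, zero_smul] at this
  exact (sub_eq_zero.mp this.symm).symm

/-- Corollary 1.2: given vectors `v 1, …, v ℓ` in `ℤ^d`, there is a constant `C > 0`
such that for all `A, B ⊆ [1,N]^d` with `|A||B|/N^(2d) ≥ 2^d·C·N^(-1/ℓ)`, there are
`r ≠ 0` and `t ∈ [2,2N]^d` with `t ± r v_j ∈ A + B` for all `j`. -/
theorem sparse_sumsets_dilate
    (d ℓ : ℕ) (hd : 1 ≤ d) (hℓ : 1 ≤ ℓ) (v : Fin ℓ → (Fin d → ℤ)) :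
    ∃ C : ℝ, 0 < C ∧
      ∀ N : ℕ, 1 ≤ N → ∀ A B : Finset (Fin d → ℤ),
        (∀ x ∈ A, ∀ i : Fin d, x i ∈ Finset.Icc (1 : ℤ) (N : ℤ)) →
        (∀ x ∈ B, ∀ i : Fin d, x i ∈ Finset.Icc (1 : ℤ) (N : ℤ)) →
        (2 : ℝ) ^ d * C * (N : ℝ) ^ (-(1 / (ℓ : ℝ)))
            ≤ ((A.card : ℝ) * B.card) / (N : ℝ) ^ (2 * d) →
        ∃ r : ℤ, r ≠ 0 ∧ ∃ t : Fin d → ℤ,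
          (∀ i : Fin d, t i ∈ Finset.Icc (2 : ℤ) (2 * N : ℤ)) ∧
          ∀ j : Fin ℓ,
            (∃ a ∈ A, ∃ b ∈ B, t + r • v j = a + b) ∧
            (∃ a ∈ A, ∃ b ∈ B, t - r • v j = a + b) := by
  classical
  obtain ⟨M, hM⟩ : ∃ M : ℕ, ∀ j i, |v j i| ≤ (M : ℤ) := by
    refine ⟨∑ j, ∑ i, (v j i).natAbs, fun j i => ?_⟩
    rw [Int.abs_eq_natAbs]
    have h1 : (v j i).natAbs ≤ ∑ i, (v j i).natAbs :=
      Finset.single_le_sum (f := fun i => (v j i).natAbs) (fun _ _ => Nat.zero_le _)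
        (Finset.mem_univ i)
    have h2 : ∑ i, (v j i).natAbs ≤ ∑ j, ∑ i, (v j i).natAbs :=
      Finset.single_le_sum (f := fun j => ∑ i, (v j i).natAbs) (fun _ _ => Nat.zero_le _)
        (Finset.mem_univ j)
    exact_mod_cast h1.trans h2
  refine ⟨2 * (2 * (M : ℝ) + 1) ^ d, by positivity, ?_⟩
  intro N hN A B hA hB h
  have hNR : (0 : ℝ) < N := by exact_mod_cast hN
  rw [le_div_iff₀ (by positivity)] at h
  set b : ℝ := (2 * (2 * (M : ℝ) + 1) ^ d) * (N : ℝ) ^ d * (N : ℝ) ^ (-(1 / (ℓ : ℝ))) with hb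
  have hb0 : 0 ≤ b := by positivity
  set T : Finset (Fin d → ℤ) := Fintype.piFinset fun _ => Finset.Icc (2 : ℤ) (2 * N) with hT
  have hTc : (T.card : ℝ) ≤ (2 * N) ^ d := by
    have h1 : T.card ≤ (2 * N) ^ d := by
      simp only [hT, Fintype.card_piFinset, Finset.prod_const, Finset.card_univ, Fintype.card_fin,
        Int.card_Icc]
      apply Nat.pow_le_pow_left
      omega
    exact_mod_cast h1
  obtain ⟨s, hs, hsb⟩ := Finset.exists_le_card_fiber_of_nsmul_le_card_of_maps_to
    (s := A ×ˢ B) (t := T) (f := fun p => p.1 + p.2) (b := b) (by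
      intro p hp
      rw [Finset.mem_product] at hp
      simp only [hT, Fintype.mem_piFinset, Finset.mem_Icc, Pi.add_apply]
      intro i
      have h1 := Finset.mem_Icc.mp (hA _ hp.1 i)
      have h2 := Finset.mem_Icc.mp (hB _ hp.2 i)
      constructor <;> linarith)
    ⟨fun _ => 2, by
      simp only [hT, Fintype.mem_piFinset, Finset.mem_Icc]
      intro i
      constructor <;> omega⟩
    (by
      rw [nsmul_eq_mul, Finset.card_product]
      push_cast
      refine le_trans (mul_le_mul_of_nonneg_right hTc hb0) (le_trans (le_of_eq ?_) h)
      rw [hb]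
      ring)
  set S := (Finset.filter (fun p => p.1 + p.2 = s) (A ×ˢ B)).image Prod.fst with hS
  have hSc : S.card = (Finset.filter (fun p => p.1 + p.2 = s) (A ×ˢ B)).card := by
    apply Finset.card_image_of_injOn
    intro p hp q hq hpq
    simp only [Finset.coe_filter, Set.mem_ofPred_eq] at hp hq
    refine Prod.ext hpq ?_
    have := hp.2.trans hq.2.symm
    rw [hpq] at this
    exact add_left_cancel this
  have hSm : ∀ x ∈ S, x ∈ A ∧ s - x ∈ B := by
    intro x hx
    simp only [hS, Finset.mem_image, Finset.mem_filter, Finset.mem_product] at hx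
    obtain ⟨p, ⟨⟨h1, h2⟩, h3⟩, rfl⟩ := hx
    refine ⟨h1, ?_⟩
    rw [← h3, add_sub_cancel_left]
    exact h2
  obtain ⟨R, hR, hRv⟩ := dilate_aux d ℓ hℓ v M hM N hN S (fun x hx => hA x (hSm x hx).1)
    (by rw [hSc]; exact hsb)
  refine ⟨R, hR, s, fun i => Fintype.mem_piFinset.mp hs i, fun j => ?_⟩
  obtain ⟨x, hx, y, hy, hxy⟩ := hRv j
  rw [hxy]
  exact ⟨⟨y, (hSm y hy).1, s - x, (hSm x hx).2, by abel⟩,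
    ⟨x, (hSm x hx).1, s - y, (hSm y hy).2, by abel⟩⟩
end

section
/- Let N ≥ 1 be an integer and let m ≥ 3 be an odd positive integer. If A ⊆ [1,N] satisfies |A|/N ≥ 4 · N^(−2/(m−1)), then A − A contains an arithmetic progression of length at least m; that is, there exist an integer a and a nonzero integer q such that a + j·q ∈ A − A for every 0 ≤ j ≤ m − 1. -/
lemma slide_exists (N k : ℕ) (hk : 0 < k) (x : Fin k → ℤ)
    (hx : ∀ i, x i ∈ Finset.Icc (1 : ℤ) (N : ℤ)) :
    ∃ t : ℕ, (∀ i, x i - t * ((i : ℕ) + 1 : ℤ) ∈ Finset.Icc (1 : ℤ) (N : ℤ)) ∧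
      ∃ j, x j - t * ((j : ℕ) + 1 : ℤ) ≤ (j : ℕ) + 1 := by
  classical
  have hex : ∃ t : ℕ, ∃ j, x j - t * ((j : ℕ) + 1 : ℤ) ≤ (j : ℕ) + 1 := by
    refine ⟨N, ⟨0, hk⟩, ?_⟩
    have := Finset.mem_Icc.1 (hx ⟨0, hk⟩)
    simp only [Nat.cast_zero]
    linarith [this.2]
  refine ⟨Nat.find hex, ?_, Nat.find_spec hex⟩
  intro i
  have hi := Finset.mem_Icc.1 (hx i)
  rw [Finset.mem_Icc]
  constructor
  · rcases h : Nat.find hex with _ | s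
    · simpa using hi.1
    · have hs := Nat.find_min hex (m := s) (by omega)
      push Not at hs
      have := hs i
      push_cast
      linarith
  · have : (0 : ℤ) ≤ (Nat.find hex : ℤ) * ((i : ℕ) + 1 : ℤ) := by positivity
    linarith [hi.2]

lemma slab_card (N k : ℕ) (j : Fin k) :
    (Fintype.piFinset (fun i : Fin k => if i = j then Finset.Icc (1 : ℤ) ((j : ℕ) + 1)
      else Finset.Icc (1 : ℤ) (N : ℤ))).card ≤ k * N ^ (k - 1) := by
  rw [Fintype.card_piFinset, ← Finset.mul_prod_erase Finset.univ _ (Finset.mem_univ j)]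
  have h1 : ∀ i ∈ Finset.univ.erase j, (if i = j then Finset.Icc (1 : ℤ) ((j : ℕ) + 1)
      else Finset.Icc (1 : ℤ) (N : ℤ)).card = N := by
    intro i hi
    simp [(Finset.mem_erase.1 hi).1]
  rw [Finset.prod_congr rfl h1, Finset.prod_const, Finset.card_erase_of_mem (Finset.mem_univ j),
    Finset.card_univ, Fintype.card_fin]
  apply Nat.mul_le_mul_right
  simp only [if_true, Int.card_Icc]
  have := j.2
  omega

lemma pigeon (N k : ℕ) (hk : 0 < k) (A : Finset ℤ) (hA : A ⊆ Finset.Icc (1 : ℤ) (N : ℤ))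
    (hc : k * (k * N ^ (k - 1)) < A.card ^ k) :
    ∃ q : ℤ, q ≠ 0 ∧ ∀ i : Fin k, ∃ x ∈ A, ∃ y ∈ A, x - y = q * ((i : ℕ) + 1 : ℤ) := by
  classical
  have key : ∀ x : Fin k → ℤ, ∃ t : ℕ, (∀ i, x i ∈ A) →
      (∀ i, x i - t * ((i : ℕ) + 1 : ℤ) ∈ Finset.Icc (1 : ℤ) (N : ℤ)) ∧
      ∃ j, x j - t * ((j : ℕ) + 1 : ℤ) ≤ (j : ℕ) + 1 := by
    intro x
    by_cases h : ∀ i, x i ∈ A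
    · obtain ⟨t, ht⟩ := slide_exists N k hk x (fun i => hA (h i))
      exact ⟨t, fun _ => ht⟩
    · exact ⟨0, fun h' => absurd h' h⟩
  choose t ht using key
  let S : Finset (Fin k → ℤ) := Finset.univ.biUnion (fun j : Fin k =>
    Fintype.piFinset (fun i : Fin k => if i = j then Finset.Icc (1 : ℤ) ((j : ℕ) + 1)
      else Finset.Icc (1 : ℤ) (N : ℤ)))
  have hS : S.card ≤ k * (k * N ^ (k - 1)) := by
    have := Finset.card_biUnion_le_card_mul (Finset.univ : Finset (Fin k))
      (fun j : Fin k =>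
    Fintype.piFinset (fun i : Fin k => if i = j then Finset.Icc (1 : ℤ) ((j : ℕ) + 1)
      else Finset.Icc (1 : ℤ) (N : ℤ))) (k * N ^ (k - 1)) (fun j _ => slab_card N k j)
    simpa using this
  have hlt : S.card < (Fintype.piFinset (fun _ : Fin k => A)).card := by
    rw [Fintype.card_piFinset]
    simpa using lt_of_le_of_lt hS hc
  obtain ⟨x, hx, y, hy, hne, he⟩ := Finset.exists_ne_map_eq_of_card_lt_of_maps_to hlt
    (f := fun x i => x i - t x * ((i : ℕ) + 1 : ℤ)) (by
      intro x hx
      have hx' : ∀ i, x i ∈ A := by simpa using hx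
      obtain ⟨h1, j, hj⟩ := ht x hx'
      simp only [S, Finset.mem_coe, Finset.mem_biUnion, Fintype.mem_piFinset]
      refine ⟨j, Finset.mem_univ j, fun i => ?_⟩
      split_ifs with h
      · subst h
        exact Finset.mem_Icc.2 ⟨(Finset.mem_Icc.1 (h1 i)).1, hj⟩
      · exact h1 i)
  have hx' : ∀ i, x i ∈ A := by simpa using hx
  have hy' : ∀ i, y i ∈ A := by simpa using hy
  have he' : ∀ i, x i - y i = ((t x : ℤ) - t y) * ((i : ℕ) + 1 : ℤ) := by
    intro i
    have := congrFun he i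
    linarith
  refine ⟨(t x : ℤ) - t y, ?_, fun i => ⟨x i, hx' i, y i, hy' i, he' i⟩⟩
  intro h0
  apply hne
  funext i
  have := he' i
  rw [h0] at this
  linarith

lemma count_bound (N k : ℕ) (hN : 1 ≤ N) (hk : 0 < k) (c : ℕ)
    (h : 4 * (N : ℝ) ^ (-(1 / (k : ℝ))) ≤ (c : ℝ) / N) :
    k * (k * N ^ (k - 1)) < c ^ k := by
  have hN0 : (0 : ℝ) < N := by exact_mod_cast hN
  have h1 : (4 * (N : ℝ) ^ (-(1 / (k : ℝ)))) ^ k ≤ ((c : ℝ) / N) ^ k :=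
    pow_le_pow_left₀ (by positivity) h k
  have hk0 : (k : ℝ) ≠ 0 := by positivity
  have h2 : ((N : ℝ) ^ (-(1 / (k : ℝ)))) ^ k = (N : ℝ)⁻¹ := by
    rw [← Real.rpow_natCast, ← Real.rpow_mul hN0.le, ← Real.rpow_neg_one]
    congr 1
    field_simp
  rw [mul_pow, h2, div_pow, le_div_iff₀ (by positivity)] at h1
  have h3 : (N : ℝ) ^ k = N * (N : ℝ) ^ (k - 1) := by
    rw [← pow_succ']; congr 1; omega
  rw [h3] at h1
  have h4 : (4 : ℝ) ^ k * (N : ℝ) ^ (k - 1) ≤ (c : ℝ) ^ k := by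
    refine le_trans (le_of_eq ?_) h1
    field_simp
  have h5 : 4 ^ k * N ^ (k - 1) ≤ c ^ k := by exact_mod_cast h4
  refine lt_of_lt_of_le ?_ h5
  rw [← mul_assoc]
  apply Nat.mul_lt_mul_of_pos_right _ (by positivity)
  have : k < 2 ^ k := Nat.lt_two_pow_self
  calc k * k < 2 ^ k * 2 ^ k := Nat.mul_lt_mul'' this this
    _ = 4 ^ k := by rw [← mul_pow]; norm_num

/-- Theorem 2.1: if `m ≥ 3` is odd and `A ⊆ [1,N]` with `|A|/N ≥ 4·N^(-2/(m-1))`,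
then `A - A` contains an arithmetic progression of length `m`. -/
theorem ap_in_sparse_difference_set
    (N : ℕ) (hN : 1 ≤ N) (m : ℕ) (hm : 3 ≤ m) (hmodd : Odd m)
    (A : Finset ℤ) (hA : A ⊆ Finset.Icc (1 : ℤ) (N : ℤ))
    (hdens : 4 * (N : ℝ) ^ (-(2 / ((m : ℝ) - 1))) ≤ (A.card : ℝ) / N) :
    ∃ a q : ℤ, q ≠ 0 ∧ ∀ j : ℕ, j ≤ m - 1 →
      ∃ x ∈ A, ∃ y ∈ A, x - y = a + (j : ℤ) * q := by
  obtain ⟨k, rfl⟩ := hmodd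
  have hk : 0 < k := by omega
  have hk0 : (k : ℝ) ≠ 0 := by positivity
  have he : (2 / (((2 * k + 1 : ℕ) : ℝ) - 1)) = 1 / (k : ℝ) := by
    push_cast
    rw [add_sub_cancel_right]
    field_simp
  rw [he] at hdens
  obtain ⟨q, hq, h⟩ := pigeon N k hk A hA (count_bound N k hN hk _ hdens)
  refine ⟨-(k * q), q, hq, fun j hj => ?_⟩
  rcases lt_trichotomy j k with hlt | rfl | hgt
  · obtain ⟨x, hx, y, hy, hxy⟩ := h ⟨k - j - 1, by omega⟩
    refine ⟨y, hy, x, hx, ?_⟩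
    have e : (((k - j - 1 : ℕ) : ℤ) + 1) = k - j := by omega
    simp only [e] at hxy
    linarith
  · obtain ⟨x, hx, _⟩ := h ⟨0, hk⟩
    exact ⟨x, hx, x, hx, by ring⟩
  · obtain ⟨x, hx, y, hy, hxy⟩ := h ⟨j - k - 1, by omega⟩
    refine ⟨x, hx, y, hy, ?_⟩
    have e : (((j - k - 1 : ℕ) : ℤ) + 1) = j - k := by omega
    simp only [e] at hxy
    linarith
end

section
/- Let N ≥ 1 and ℓ ≥ 1 be integers. If A ⊆ [1,N] satisfies |A|/N ≥ 2·(2ℓ)^(1/ℓ) · N^(−1/ℓ), then there exists an integer r > 0 such that j·r ∈ A − A for every integer j with |j| ≤ ℓ (so that A − A contains an arithmetic progression of length 2ℓ + 1 centered at 0 with common difference r). -/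
/-- If `A ⊆ [1,N]` with `|A|/N ≥ 2·(2ℓ)^(1/ℓ)·N^(-1/ℓ)`, then there is `r > 0` with
`j·r ∈ A - A` for all `|j| ≤ ℓ`, i.e. `A - A` contains a symmetric progression of
length `2ℓ+1` centered at `0`. -/
theorem symmetric_ap_in_sparse_difference_set
    (N ℓ : ℕ) (hN : 1 ≤ N) (hℓ : 1 ≤ ℓ)
    (A : Finset ℤ) (hA : A ⊆ Finset.Icc (1 : ℤ) (N : ℤ))
    (hdens : 2 * (2 * (ℓ : ℝ)) ^ (1 / (ℓ : ℝ)) * (N : ℝ) ^ (-(1 / (ℓ : ℝ)))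
        ≤ (A.card : ℝ) / N) :
    ∃ r : ℤ, 0 < r ∧ ∀ j : ℤ, |j| ≤ (ℓ : ℤ) →
      ∃ x ∈ A, ∃ y ∈ A, x - y = j * r := by
  have hNR : (0 : ℝ) < N := by exact_mod_cast hN
  have hlR : (0 : ℝ) < ℓ := by exact_mod_cast hℓ
  have hl0 : ℓ ≠ 0 := by omega
  -- the density hypothesis in polynomial form
  have hpow : 2 ^ ℓ * (2 * (ℓ : ℝ)) * (N : ℝ) ^ ℓ ≤ (A.card : ℝ) ^ ℓ * N := by
    have h := pow_le_pow_left₀ (by positivity) hdens ℓ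
    rw [mul_pow, mul_pow, Real.rpow_neg hNR.le, inv_pow, one_div,
      Real.rpow_inv_natCast_pow (by positivity) hl0,
      Real.rpow_inv_natCast_pow hNR.le hl0, div_pow, ← div_eq_mul_inv,
      div_le_div_iff₀ hNR (by positivity)] at h
    exact h
  have hAne : A.Nonempty := by
    rw [Finset.nonempty_iff_ne_empty]
    rintro rfl
    simp only [Finset.card_empty, Nat.cast_zero, zero_pow hl0, zero_mul] at hpow
    have : 0 < 2 ^ ℓ * (2 * (ℓ : ℝ)) * (N : ℝ) ^ ℓ := by positivity
    linarith
  set T := N / ℓ with hT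
  have hT1 : ℓ * T ≤ N := Nat.mul_div_le N ℓ
  have hT2 : N < ℓ * (T + 1) := by
    have := Nat.lt_mul_div_succ N (show 0 < ℓ by omega)
    simpa using this
  have hpowN : 2 ^ ℓ * (2 * ℓ) * N ^ ℓ ≤ A.card ^ ℓ * N := by exact_mod_cast hpow
  have hcount : (2 * N) ^ ℓ < A.card ^ ℓ * (T + 1) := by
    have hX : 0 < (2 * N) ^ ℓ := by positivity
    have h1 : ℓ * (2 * (2 * N) ^ ℓ) ≤ ℓ * (A.card ^ ℓ * (T + 1)) := by
      calc ℓ * (2 * (2 * N) ^ ℓ) = 2 ^ ℓ * (2 * ℓ) * N ^ ℓ := by rw [mul_pow]; ring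
        _ ≤ A.card ^ ℓ * N := hpowN
        _ ≤ A.card ^ ℓ * (ℓ * (T + 1)) := Nat.mul_le_mul_left _ hT2.le
        _ = _ := by ring
    have h2 := Nat.le_of_mul_le_mul_left h1 (by omega)
    omega
  -- pigeonhole
  let D := (Fintype.piFinset (fun _ : Fin ℓ => A)) ×ˢ Finset.range (T + 1)
  let E := Fintype.piFinset (fun _ : Fin ℓ => Finset.Icc (1 : ℤ) ((2 * N : ℕ) : ℤ))
  let f : (Fin ℓ → ℤ) × ℕ → (Fin ℓ → ℤ) := fun p i => p.1 i + ((i : ℕ) + 1 : ℤ) * p.2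
  have hcard : E.card < D.card := by
    simp only [E, D, Finset.card_product, Fintype.card_piFinset, Finset.prod_const,
      Finset.card_univ, Fintype.card_fin, Finset.card_range, Int.card_Icc]
    rwa [show (((2 * N : ℕ) : ℤ) + 1 - 1).toNat = 2 * N by omega]
  have hmaps : ∀ p ∈ D, f p ∈ E := by
    rintro ⟨a, t⟩ hp
    simp only [D, Finset.mem_product, Fintype.mem_piFinset, Finset.mem_range] at hp
    simp only [E, f, Fintype.mem_piFinset, Finset.mem_Icc]
    intro i
    have ha := Finset.mem_Icc.1 (hA (hp.1 i))
    have hit : ((i : ℕ) + 1) * t ≤ N :=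
      (Nat.mul_le_mul (show (i : ℕ) + 1 ≤ ℓ from i.2) (show t ≤ T by omega)).trans hT1
    have hit' : (((i : ℕ) + 1 : ℤ)) * t ≤ N := by exact_mod_cast hit
    have hit0 : 0 ≤ (((i : ℕ) + 1 : ℤ)) * t := by positivity
    push_cast
    constructor <;> linarith [ha.1, ha.2]
  obtain ⟨⟨a, t⟩, hp, ⟨b, s⟩, hq, hne, hf⟩ :=
    Finset.exists_ne_map_eq_of_card_lt_of_maps_to hcard hmaps
  simp only [D, Finset.mem_product, Fintype.mem_piFinset, Finset.mem_range] at hp hq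
  have hfi : ∀ i : Fin ℓ, a i + ((i : ℕ) + 1 : ℤ) * t = b i + ((i : ℕ) + 1 : ℤ) * s :=
    fun i => congrFun hf i
  have hr : (s : ℤ) - t ≠ 0 := by
    intro h
    have hst : t = s := by omega
    subst hst
    apply hne
    have : a = b := by
      funext i
      have := hfi i
      linarith
    rw [this]
  have hpos : ∀ j : ℤ, 0 < j → j ≤ ℓ → ∃ x ∈ A, ∃ y ∈ A, x - y = j * ((s : ℤ) - t) := by
    intro j h0 hj
    have hi : (j - 1).toNat < ℓ := by omega
    refine ⟨_, hp.1 ⟨_, hi⟩, _, hq.1 ⟨_, hi⟩, ?_⟩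
    have h := hfi ⟨_, hi⟩
    have hc : (((j - 1).toNat : ℕ) : ℤ) + 1 = j := by omega
    simp only [hc] at h
    linarith
  have hall : ∀ j : ℤ, |j| ≤ ℓ → ∃ x ∈ A, ∃ y ∈ A, x - y = j * ((s : ℤ) - t) := by
    intro j hj
    rw [abs_le] at hj
    rcases lt_trichotomy j 0 with h | h | h
    · obtain ⟨x, hx, y, hy, hxy⟩ := hpos (-j) (by omega) (by omega)
      exact ⟨y, hy, x, hx, by linarith⟩
    · obtain ⟨x, hx⟩ := hAne
      exact ⟨x, hx, x, hx, by simp [h]⟩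
    · exact hpos j h hj.2
  refine ⟨|(s : ℤ) - t|, abs_pos.2 hr, fun j hj => ?_⟩
  rcases abs_choice ((s : ℤ) - t) with h | h
  · rw [h]; exact hall j hj
  · rw [h]
    obtain ⟨x, hx, y, hy, hxy⟩ := hall (-j) (by rwa [abs_neg])
    exact ⟨x, hx, y, hy, by linarith⟩
end

section
/- Let N ≥ 1 and ℓ ≥ 1 be integers with ℓ ≤ N, and let A ⊆ [1,N]. Then there exists w = (w_1, …, w_ℓ) ∈ ℤ^ℓ such that the number of integers r ∈ [1, ⌊N/ℓ⌋] satisfying j·r + w_j ∈ A for every 1 ≤ j ≤ ℓ is at least |A|^ℓ · ⌊N/ℓ⌋ / (2^ℓ · N^ℓ). -/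
/-- The pigeonhole step in the proof of Theorem 2.1: there exists `w ∈ ℤ^ℓ` such that
the number of `r ∈ [1, ⌊N/ℓ⌋]` with `j·r + w_j ∈ A` for all `1 ≤ j ≤ ℓ` is at least
`|A|^ℓ·⌊N/ℓ⌋/(2^ℓ·N^ℓ)`. -/
theorem exists_good_shift_vector
    (N ℓ : ℕ) (hN : 1 ≤ N) (hℓ : 1 ≤ ℓ) (hℓN : ℓ ≤ N)
    (A : Finset ℤ) (hA : A ⊆ Finset.Icc (1 : ℤ) (N : ℤ)) :
    ∃ w : Fin ℓ → ℤ,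
      (A.card : ℝ) ^ ℓ * ((N / ℓ : ℕ) : ℝ) / (2 ^ ℓ * (N : ℝ) ^ ℓ)
        ≤ (((Finset.Icc (1 : ℤ) ((N / ℓ : ℕ) : ℤ)).filter
            fun r => ∀ j : Fin ℓ, ((j : ℕ) + 1 : ℤ) * r + w j ∈ A).card : ℝ) := by
  classical
  set M : ℕ := N / ℓ with hM
  have hMN : (ℓ : ℤ) * (M : ℤ) ≤ N := by
    have := Nat.mul_div_le N ℓ
    exact_mod_cast this
  set S : Finset (Fin ℓ → ℤ) := Fintype.piFinset fun _ => Finset.Ico (-(N : ℤ)) (N : ℤ) with hS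
  have hScard : S.card = (2 * N) ^ ℓ := by
    rw [hS, Fintype.card_piFinset]
    simp only [Int.card_Ico, Finset.prod_const, Finset.card_univ, Fintype.card_fin]
    congr 1
    omega
  have hSne : S.Nonempty := by
    rw [← Finset.card_pos, hScard]
    positivity
  -- for each fixed `r`, the admissible vectors are counted by `A ^ ℓ`
  have hr : ∀ r ∈ Finset.Icc (1 : ℤ) (M : ℤ),
      (S.filter fun w => ∀ j : Fin ℓ, ((j : ℕ) + 1 : ℤ) * r + w j ∈ A).card = A.card ^ ℓ := by
    intro r hr
    rw [Finset.mem_Icc] at hr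
    have hpi : (Fintype.piFinset fun _ : Fin ℓ => A).card = A.card ^ ℓ := by
      simp [Fintype.card_piFinset]
    rw [← hpi]
    refine Finset.card_bij' (fun w _ j => ((j : ℕ) + 1 : ℤ) * r + w j)
      (fun a _ j => a j - ((j : ℕ) + 1 : ℤ) * r) ?_ ?_ ?_ ?_
    · intro w hw
      rw [Finset.mem_filter] at hw
      exact Fintype.mem_piFinset.2 hw.2
    · intro a ha
      rw [Fintype.mem_piFinset] at ha
      rw [Finset.mem_filter, hS, Fintype.mem_piFinset]
      refine ⟨fun j => ?_, fun j => ?_⟩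
      · have h1 := Finset.mem_Icc.1 (hA (ha j))
        have hj : ((j : ℕ) + 1 : ℤ) ≤ ℓ := by exact_mod_cast j.2
        have h2 : ((j : ℕ) + 1 : ℤ) * r ≤ ℓ * M :=
          mul_le_mul hj hr.2 (by omega) (by omega)
        have h3 : 0 < ((j : ℕ) + 1 : ℤ) * r := mul_pos (by omega) (by omega)
        rw [Finset.mem_Ico]
        constructor <;> linarith
      · simpa using ha j
    · intro w _
      funext j
      simp
    · intro a _
      funext j
      simp
  have hdc : ∑ w ∈ S, ((Finset.Icc (1 : ℤ) (M : ℤ)).filter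
      fun r => ∀ j : Fin ℓ, ((j : ℕ) + 1 : ℤ) * r + w j ∈ A).card = M * A.card ^ ℓ := by
    have := Finset.sum_card_bipartiteAbove_eq_sum_card_bipartiteBelow (s := S)
      (t := Finset.Icc (1 : ℤ) (M : ℤ))
      (fun w r => ∀ j : Fin ℓ, ((j : ℕ) + 1 : ℤ) * r + w j ∈ A)
    unfold Finset.bipartiteAbove Finset.bipartiteBelow at this
    rw [this, Finset.sum_congr rfl hr]
    simp
  have hN0 : (N : ℝ) ≠ 0 := by
    have : N ≠ 0 := by omega
    exact_mod_cast this
  obtain ⟨w, _, hw⟩ := Finset.exists_le_of_sum_le (s := S)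
    (f := fun _ => (A.card : ℝ) ^ ℓ * (M : ℝ) / (2 ^ ℓ * (N : ℝ) ^ ℓ))
    (g := fun w => (((Finset.Icc (1 : ℤ) (M : ℤ)).filter
            fun r => ∀ j : Fin ℓ, ((j : ℕ) + 1 : ℤ) * r + w j ∈ A).card : ℝ)) hSne (by
      rw [← Nat.cast_sum, hdc, Finset.sum_const, hScard, nsmul_eq_mul]
      push_cast
      rw [mul_pow]
      apply le_of_eq
      field_simp)
  refine ⟨w, ?_⟩
  convert hw
end

section
/- Let k ≥ 1 and let P(r) = a_k r^k + a_{k−1} r^{k−1} + ⋯ + a_1 r + a_0 be a polynomial with integer coefficients and leading coefficient a_k > 0. Then there exists a threshold N₀ (depending on P) such that for every integer N ≥ N₀ and every set A ⊆ [1,N] with |A|/N ≥ 4·a_k^(1/k) · N^(−1/k), there exist positive integers r' ≠ r'' such that P(r') − P(r'') ∈ A − A. -/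
/-- Theorem 3.1: for a polynomial `P` of degree `k ≥ 1` with positive leading
coefficient `a_k`, there is a threshold `N₀` such that for `N ≥ N₀` any `A ⊆ [1,N]`
with `|A|/N ≥ 4·a_k^(1/k)·N^(-1/k)` satisfies `P(r') - P(r'') ∈ A - A` for some
distinct positive integers `r', r''`. -/
theorem poly_difference_in_sparse_difference_set
    (k : ℕ) (hk : 1 ≤ k) (P : Polynomial ℤ) (hdeg : P.natDegree = k)
    (hlead : 0 < P.leadingCoeff) :
    ∃ N₀ : ℕ, ∀ N : ℕ, N₀ ≤ N → ∀ A : Finset ℤ, A ⊆ Finset.Icc (1 : ℤ) (N : ℤ) →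
      4 * (P.leadingCoeff : ℝ) ^ (1 / (k : ℝ)) * (N : ℝ) ^ (-(1 / (k : ℝ)))
        ≤ (A.card : ℝ) / N →
      ∃ r' r'' : ℤ, 0 < r' ∧ 0 < r'' ∧ r' ≠ r'' ∧
        ∃ x ∈ A, ∃ y ∈ A, x - y = P.eval r' - P.eval r'' := by
  have hk0 : k ≠ 0 := by omega
  set a := P.leadingCoeff with ha
  set S : ℤ := ∑ i ∈ Finset.range k, |P.coeff i| with hS
  have hS0 : 0 ≤ S := Finset.sum_nonneg (fun i _ => abs_nonneg _)
  have hQ : ∀ r : ℤ, 1 ≤ r → |P.eval r - a * r ^ k| ≤ S * r ^ (k - 1) := by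
    intro r hr
    have h1 : P.eval r - a * r ^ k = ∑ i ∈ Finset.range k, P.coeff i * r ^ i := by
      rw [Polynomial.eval_eq_sum_range, hdeg, Finset.sum_range_succ, ha,
        Polynomial.leadingCoeff, hdeg]
      ring
    rw [h1, hS, Finset.sum_mul]
    refine (Finset.abs_sum_le_sum_abs _ _).trans (Finset.sum_le_sum ?_)
    intro i hi
    have hi' := Finset.mem_range.mp hi
    rw [abs_mul, abs_of_nonneg (by positivity : (0 : ℤ) ≤ r ^ i)]
    exact mul_le_mul_of_nonneg_left (pow_le_pow_right₀ hr (by omega)) (abs_nonneg _)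
  have haR : (0 : ℝ) < (a : ℝ) := by exact_mod_cast hlead
  have ha1 : (1 : ℝ) ≤ (a : ℝ) := by exact_mod_cast hlead
  have hSR : (0 : ℝ) ≤ (S : ℝ) := by exact_mod_cast hS0
  obtain ⟨N₁, hN₁⟩ := exists_nat_ge ((a : ℝ) * (4 * ((S : ℝ) + 1)) ^ k)
  refine ⟨N₁ + 3, fun N hN A hA hcard => ?_⟩
  have hN3 : (3 : ℝ) ≤ (N : ℝ) := by
    have : 3 ≤ N := by omega
    exact_mod_cast this
  have hNpos : (0 : ℝ) < (N : ℝ) := by linarith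
  have hNN : (a : ℝ) * (4 * ((S : ℝ) + 1)) ^ k ≤ N := by
    have : (N₁ : ℝ) ≤ N := by exact_mod_cast (by omega : N₁ ≤ N)
    linarith
  set X : ℝ := ((N : ℝ) / a) ^ (1 / (k : ℝ)) with hX
  have hXpos : 0 < X := by positivity
  have hXk : X ^ k = N / a := by
    rw [hX, one_div, Real.rpow_inv_natCast_pow (by positivity) hk0]
  have haX : a * X ^ k = N := by rw [hXk]; field_simp
  have hXM : 4 * ((S : ℝ) + 1) ≤ X := by
    apply le_of_pow_le_pow_left₀ hk0 hXpos.le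
    rw [hXk, le_div_iff₀ haR]
    linarith
  have hAX : 4 * (N : ℝ) ≤ A.card * X := by
    have h1 : (a : ℝ) ^ (1 / (k : ℝ)) * (N : ℝ) ^ (-(1 / (k : ℝ))) * X = 1 := by
      rw [hX, Real.div_rpow hNpos.le haR.le, Real.rpow_neg hNpos.le]
      have h2 : (a : ℝ) ^ (1 / (k : ℝ)) ≠ 0 := by positivity
      have h3 : (N : ℝ) ^ (1 / (k : ℝ)) ≠ 0 := by positivity
      generalize (a : ℝ) ^ (1 / (k : ℝ)) = u at *
      generalize (N : ℝ) ^ (1 / (k : ℝ)) = v at *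
      field_simp
    rw [le_div_iff₀ hNpos] at hcard
    have h4 := mul_le_mul_of_nonneg_right hcard hXpos.le
    calc 4 * (N : ℝ) = 4 * N * ((a : ℝ) ^ (1 / (k : ℝ)) * (N : ℝ) ^ (-(1 / (k : ℝ))) * X) := by
          rw [h1, mul_one]
      _ = 4 * (a : ℝ) ^ (1 / (k : ℝ)) * (N : ℝ) ^ (-(1 / (k : ℝ))) * N * X := by ring
      _ ≤ _ := h4
  set R : ℕ := ⌊X⌋₊ with hR
  have hRX : (R : ℝ) ≤ X := Nat.floor_le hXpos.le
  have hXR : X < R + 1 := Nat.lt_floor_add_one X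
  have hR34 : 3 / 4 * X ≤ R := by linarith
  have hAR : 3 * (N : ℝ) ≤ A.card * R := by
    have := mul_le_mul_of_nonneg_left hR34 (Nat.cast_nonneg (α := ℝ) A.card)
    linarith
  have hbound : ∀ r ∈ Finset.Icc (1 : ℤ) (R : ℤ),
      -(N : ℤ) ≤ 4 * P.eval r ∧ 4 * P.eval r ≤ 5 * (N : ℤ) := by
    intro r hr
    obtain ⟨hr1, hr2⟩ := Finset.mem_Icc.mp hr
    have hr1R : (1 : ℝ) ≤ (r : ℝ) := by exact_mod_cast hr1
    have hr2R : (r : ℝ) ≤ X := le_trans (by exact_mod_cast hr2) hRX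
    have h1 : |((P.eval r : ℤ) : ℝ) - a * (r : ℝ) ^ k| ≤ S * (r : ℝ) ^ (k - 1) := by
      exact_mod_cast hQ r hr1
    have h2 : (r : ℝ) ^ k ≤ X ^ k := by gcongr
    have h3 : (r : ℝ) ^ (k - 1) ≤ X ^ (k - 1) := by gcongr
    have h4 : X ^ k = X * X ^ (k - 1) := (mul_pow_sub_one hk0 X).symm
    have h5 : 0 ≤ X ^ (k - 1) := by positivity
    have h6 : 4 * (S * (r : ℝ) ^ (k - 1)) ≤ N := by
      calc 4 * (S * (r : ℝ) ^ (k - 1)) ≤ 4 * (S * X ^ (k - 1)) := by gcongr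
        _ = (4 * S) * X ^ (k - 1) := by ring
        _ ≤ X * X ^ (k - 1) := by gcongr; linarith
        _ = 1 * X ^ k := by rw [h4, one_mul]
        _ ≤ a * X ^ k := by gcongr
        _ = N := haX
    have h7 : (a : ℝ) * (r : ℝ) ^ k ≤ N := by
      rw [← haX]; gcongr
    have h8 : 0 ≤ (a : ℝ) * (r : ℝ) ^ k := by positivity
    obtain ⟨h9, h10⟩ := abs_le.mp h1
    constructor
    · have : -(N : ℝ) ≤ 4 * ((P.eval r : ℤ) : ℝ) := by linarith
      exact_mod_cast this
    · have : 4 * ((P.eval r : ℤ) : ℝ) ≤ 5 * (N : ℝ) := by linarith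
      exact_mod_cast this
  have hcardN : 3 * N ≤ A.card * R := by exact_mod_cast hAR
  obtain ⟨p, hp, q, hq, hpq, hf⟩ := Finset.exists_ne_map_eq_of_card_lt_of_maps_to
    (s := A ×ˢ Finset.Icc (1 : ℤ) (R : ℤ))
    (t := Finset.Icc (-((N : ℤ) / 4)) (2 * N + (N : ℤ) / 4))
    (f := fun p => p.1 + P.eval p.2)
    (by
      rw [Finset.card_product, Int.card_Icc, Int.card_Icc]
      have : ((R : ℤ) + 1 - 1).toNat = R := by omega
      rw [this]
      refine lt_of_lt_of_le ?_ hcardN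
      omega)
    (by
      intro p hp
      obtain ⟨h1, h2⟩ := Finset.mem_product.mp hp
      have h3 := Finset.mem_Icc.mp (hA h1)
      have h4 := hbound _ h2
      simp only [Finset.coe_Icc, Set.mem_Icc]
      constructor <;> omega)
  obtain ⟨hp1, hp2⟩ := Finset.mem_product.mp hp
  obtain ⟨hq1, hq2⟩ := Finset.mem_product.mp hq
  have hp3 := Finset.mem_Icc.mp hp2
  have hq3 := Finset.mem_Icc.mp hq2

  refine ⟨p.2, q.2, by omega, by omega, ?_, q.1, hq1, p.1, hp1, by linarith⟩
  intro h
  apply hpq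
  rw [h] at hf
  exact Prod.ext (by linarith) h
end

section
/- Let k ≥ 1 and a ≥ 1 be integers. For every integer N ≥ 1 and every set A ⊆ [1,N] with |A|/N ≥ 4·a^(1/k) · N^(−1/k), there exist positive integers r' ≠ r'' such that a·(r'^k − r''^k) ∈ A − A. (In this monomial case P(r) = a·r^k no assumption that N is sufficiently large is needed.) -/
/-- The monomial case `P(r) = a·r^k`: for every `N ≥ 1` (no largeness assumption),
if `A ⊆ [1,N]` with `|A|/N ≥ 4·a^(1/k)·N^(-1/k)`, then `a·(r'^k - r''^k) ∈ A - A`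
for some distinct positive integers `r', r''`. -/
theorem monomial_difference_in_sparse_difference_set
    (k : ℕ) (hk : 1 ≤ k) (a : ℤ) (ha : 1 ≤ a)
    (N : ℕ) (hN : 1 ≤ N) (A : Finset ℤ) (hA : A ⊆ Finset.Icc (1 : ℤ) (N : ℤ))
    (hdens : 4 * (a : ℝ) ^ (1 / (k : ℝ)) * (N : ℝ) ^ (-(1 / (k : ℝ)))
        ≤ (A.card : ℝ) / N) :
    ∃ r' r'' : ℤ, 0 < r' ∧ 0 < r'' ∧ r' ≠ r'' ∧
      ∃ x ∈ A, ∃ y ∈ A, x - y = a * (r' ^ k - r'' ^ k) := by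
  have hNr : (0 : ℝ) < N := by exact_mod_cast hN
  have har : (0 : ℝ) < a := by exact_mod_cast ha
  have hk0 : k ≠ 0 := by omega
  obtain ⟨t, ht⟩ : ∃ t : ℝ, t = ((N : ℝ) / a) ^ (1 / (k : ℝ)) := ⟨_, rfl⟩
  have htpos : 0 < t := by rw [ht]; positivity
  have htk : t ^ k = (N : ℝ) / a := by
    rw [ht, one_div]
    exact Real.rpow_inv_natCast_pow (by positivity) hk0
  have hinv : (a : ℝ) ^ (1 / (k : ℝ)) * (N : ℝ) ^ (-(1 / (k : ℝ))) = 1 / t := by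
    rw [ht, Real.div_rpow hNr.le har.le, Real.rpow_neg hNr.le]
    field_simp
  rw [mul_assoc, hinv, le_div_iff₀ hNr] at hdens
  have hcard : (A.card : ℝ) ≤ N := by
    have h := Finset.card_le_card hA
    simp at h
    exact_mod_cast h
  have h1 : 4 * (N : ℝ) ≤ A.card * t := by
    have h := mul_le_mul_of_nonneg_right hdens htpos.le
    have e : 4 * (1 / t) * (N : ℝ) * t = 4 * N := by field_simp
    linarith
  have ht4 : 4 ≤ t := by
    have h := mul_le_mul_of_nonneg_right hcard htpos.le
    by_contra hc
    push Not at hc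
    have := mul_lt_mul_of_pos_left hc hNr
    linarith
  have hMle : ((⌊t⌋₊ : ℕ) : ℝ) ≤ t := Nat.floor_le htpos.le
  have hMgt : t < (⌊t⌋₊ : ℕ) + 1 := Nat.lt_floor_add_one t
  generalize ⌊t⌋₊ = M at hMle hMgt
  have hMk : a * (M : ℤ) ^ k ≤ N := by
    have h : (M : ℝ) ^ k ≤ N / a := htk ▸ pow_le_pow_left₀ (by positivity) hMle k
    rw [le_div_iff₀ har] at h
    have h2 : (a : ℝ) * (M : ℝ) ^ k ≤ N := by linarith
    exact_mod_cast h2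
  have hApos : (0 : ℝ) < A.card := by
    by_contra hc
    push Not at hc
    have := mul_nonpos_of_nonpos_of_nonneg hc htpos.le
    linarith
  have hbig : 2 * N < A.card * M := by
    have h : t < 2 * (M : ℝ) := by linarith
    have := mul_lt_mul_of_pos_left h hApos
    have h3 : 2 * (N : ℝ) < A.card * M := by linarith
    exact_mod_cast h3
  have hpig := Finset.exists_ne_map_eq_of_card_lt_of_maps_to
    (s := A ×ˢ Finset.Icc (1 : ℤ) (M : ℤ)) (t := Finset.Icc (1 : ℤ) (2 * N : ℤ))
    (f := fun p => p.1 + a * p.2 ^ k) (by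
      rw [Finset.card_product, Int.card_Icc, Int.card_Icc]
      have e1 : ((2 * N : ℤ) + 1 - 1).toNat = 2 * N := by omega
      have e2 : ((M : ℤ) + 1 - 1).toNat = M := by omega
      rw [e1, e2]; exact hbig) (by
      rintro ⟨x, r⟩ hp
      simp only [Finset.coe_product, Set.mem_prod, Finset.mem_coe, Finset.mem_Icc] at hp
      have hx := Finset.mem_Icc.mp (hA hp.1)
      have hr : r ^ k ≤ (M : ℤ) ^ k := pow_le_pow_left₀ (by omega) hp.2.2 k
      have hr0 : 0 ≤ r ^ k := pow_nonneg (by omega) k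
      have h5 : a * r ^ k ≤ a * (M : ℤ) ^ k := mul_le_mul_of_nonneg_left hr (by omega)
      have h6 : 0 ≤ a * r ^ k := mul_nonneg (by omega) hr0
      simp only [Finset.mem_coe, Finset.mem_Icc]
      constructor <;> linarith [hx.1, hx.2])
  obtain ⟨⟨x, r⟩, hp, ⟨y, s⟩, hq, hne, heq⟩ := hpig
  simp only [Finset.mem_product, Finset.mem_Icc] at hp hq heq
  refine ⟨s, r, by omega, by omega, ?_, x, hp.1, y, hq.1, by linarith⟩
  rintro rfl
  apply hne
  have : x = y := by linarith
  rw [this]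
end

section
/- Let d ≥ 1, ℓ ≥ 1 and k ≥ 1 be integers, let v_1, …, v_ℓ be vectors in ℤ^d, and let P_1, …, P_ℓ be polynomials with integer coefficients satisfying 1 ≤ deg P_j ≤ k for each j. Then there exist a constant C > 0 and a threshold N₀ (both depending on the v_j and P_j) such that for every integer N ≥ N₀ and every set A ⊆ [1,N]^d with |A|/N^d ≥ C · N^(−1/(ℓk)), there exist positive integers r' ≠ r'' such that (P_j(r') − P_j(r''))·v_j ∈ A − A for every 1 ≤ j ≤ ℓ. -/
lemma poly_bound (k : ℕ) (p : Polynomial ℤ) (h : p.natDegree ≤ k) (r : ℤ) (hr : 1 ≤ r) :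
    |p.eval r| ≤ (∑ i ∈ Finset.range (p.natDegree + 1), |p.coeff i|) * r ^ k := by
  rw [Polynomial.eval_eq_sum_range, Finset.sum_mul]
  refine (Finset.abs_sum_le_sum_abs _ _).trans (Finset.sum_le_sum fun i hi => ?_)
  rw [abs_mul, abs_pow, abs_of_nonneg (by linarith : (0:ℤ) ≤ r)]
  have : i ≤ k := by simp at hi; omega
  gcongr

lemma uniform_bound (d ℓ k : ℕ) (v : Fin ℓ → (Fin d → ℤ)) (P : Fin ℓ → Polynomial ℤ)
    (hdeg : ∀ j, (P j).natDegree ≤ k) :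
    ∃ B : ℕ, ∀ r : ℤ, 1 ≤ r → ∀ j i, |(P j).eval r * v j i| ≤ B * r ^ k := by
  let S : Fin ℓ → ℤ := fun j => ∑ i ∈ Finset.range ((P j).natDegree + 1), |(P j).coeff i|
  have hS : ∀ j, 0 ≤ S j := fun j => Finset.sum_nonneg fun _ _ => abs_nonneg _
  refine ⟨(∑ j, ∑ i, S j * |v j i|).toNat, fun r hr j i => ?_⟩
  have h0 : ∀ j i, 0 ≤ S j * |v j i| := fun j i => mul_nonneg (hS j) (abs_nonneg _)
  rw [Int.toNat_of_nonneg (Finset.sum_nonneg fun j _ => Finset.sum_nonneg fun i _ => h0 j i)]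
  have h1 : S j * |v j i| ≤ ∑ j, ∑ i, S j * |v j i| :=
    (Finset.single_le_sum (f := fun i => S j * |v j i|) (fun i _ => h0 j i) (Finset.mem_univ i)).trans
      (Finset.single_le_sum (f := fun j => ∑ i, S j * |v j i|)
        (fun j _ => Finset.sum_nonneg fun i _ => h0 j i) (Finset.mem_univ j))
  have h2 := poly_bound k (P j) (hdeg j) r hr
  have hp : 0 ≤ r ^ k := by positivity
  calc |(P j).eval r * v j i| = |(P j).eval r| * |v j i| := abs_mul _ _
    _ ≤ (S j * r ^ k) * |v j i| := by gcongr
    _ = (S j * |v j i|) * r ^ k := by ring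
    _ ≤ _ := by gcongr


/-- Theorem 3.2: given vectors `v_j ∈ ℤ^d` and polynomials `P_j` with
`1 ≤ deg P_j ≤ k`, there are `C > 0` and a threshold `N₀` such that for `N ≥ N₀`
any `A ⊆ [1,N]^d` with `|A|/N^d ≥ C·N^(-1/(ℓk))` contains
`(P_j(r') - P_j(r''))·v_j ∈ A - A` for all `j`, for some distinct positive
integers `r', r''`. -/
theorem nonisotropic_poly_configuration_in_difference_set
    (d ℓ k : ℕ) (hd : 1 ≤ d) (hℓ : 1 ≤ ℓ) (hk : 1 ≤ k)
    (v : Fin ℓ → (Fin d → ℤ)) (P : Fin ℓ → Polynomial ℤ)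
    (hdeg : ∀ j, 1 ≤ (P j).natDegree ∧ (P j).natDegree ≤ k) :
    ∃ C : ℝ, 0 < C ∧ ∃ N₀ : ℕ,
      ∀ N : ℕ, N₀ ≤ N → ∀ A : Finset (Fin d → ℤ),
        (∀ x ∈ A, ∀ i : Fin d, x i ∈ Finset.Icc (1 : ℤ) (N : ℤ)) →
        C * (N : ℝ) ^ (-(1 / ((ℓ : ℝ) * k))) ≤ (A.card : ℝ) / (N : ℝ) ^ d →
        ∃ r' r'' : ℤ, 0 < r' ∧ 0 < r'' ∧ r' ≠ r'' ∧
          ∀ j : Fin ℓ, ∃ a ∈ A, ∃ a' ∈ A,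
            a - a' = ((P j).eval r' - (P j).eval r'') • v j := by
  obtain ⟨B, hB⟩ := uniform_bound d ℓ k v P (fun j => (hdeg j).2)
  refine ⟨3 * (2 * B + 2) ^ d, by positivity, 1, fun N hN A hA hcard => ?_⟩
  have hN0 : (0:ℝ) < N := by exact_mod_cast hN
  have hN1 : (1:ℝ) ≤ N := by exact_mod_cast hN
  have hℓ0 : (ℓ:ℝ) ≠ 0 := by positivity
  have hk0 : (k:ℝ) ≠ 0 := by positivity
  set x : ℝ := (N:ℝ) ^ (1 / (k:ℝ)) with hx
  have hx1 : 1 ≤ x := Real.one_le_rpow hN1 (by positivity)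
  have hxk : x ^ k = N := by
    rw [hx, ← Real.rpow_natCast, ← Real.rpow_mul hN0.le, one_div, inv_mul_cancel₀ hk0, Real.rpow_one]
  set M : ℕ := ⌊x⌋₊ with hM
  have hMx : (M:ℝ) ≤ x := Nat.floor_le (by linarith)
  have hMx2 : x ≤ 2 * M := by
    have h1 : x < M + 1 := Nat.lt_floor_add_one x
    have h2 : (1:ℝ) ≤ M := by exact_mod_cast Nat.le_floor (by simpa using hx1)
    linarith
  have hMk : M ^ k ≤ N := by
    have : (M:ℝ) ^ k ≤ N := by rw [← hxk]; gcongr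
    exact_mod_cast this
  -- size of A
  have hA1 : 3 * (2 * (B:ℝ) + 2) ^ d * (N : ℝ) ^ (-(1 / ((ℓ : ℝ) * k))) * (N:ℝ) ^ d ≤ A.card := by
    rwa [le_div_iff₀ (by positivity)] at hcard
  have hA2 : (3 * (2 * (B:ℝ) + 2) ^ d) ^ ℓ * x⁻¹ * ((N:ℝ) ^ d) ^ ℓ ≤ (A.card : ℝ) ^ ℓ := by
    have h := pow_le_pow_left₀ (by positivity) hA1 ℓ
    have e : ((N : ℝ) ^ (-(1 / ((ℓ : ℝ) * k)))) ^ ℓ = x⁻¹ := by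
      rw [hx, ← Real.rpow_neg hN0.le, ← Real.rpow_natCast, ← Real.rpow_mul hN0.le]
      congr 1
      field_simp
    rwa [mul_pow, mul_pow, e] at h
  have key : (((2 * B + 2) * N) ^ d) ^ ℓ < M * A.card ^ ℓ := by
    have h3 : (3:ℝ) ≤ 3 ^ ℓ := le_self_pow₀ (by norm_num) (by omega)
    have hM' : x / 2 ≤ M := by linarith
    set Q : ℝ := (((2 * (B:ℝ) + 2) * N) ^ d) ^ ℓ with hQ
    have hQ0 : 0 < Q := by positivity
    have : Q < M * (A.card:ℝ) ^ ℓ := by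
      calc Q < 3 / 2 * Q := by linarith
        _ ≤ 3 ^ ℓ / 2 * Q := by gcongr
        _ = x / 2 * ((3 * (2 * (B:ℝ) + 2) ^ d) ^ ℓ * x⁻¹ * ((N:ℝ) ^ d) ^ ℓ) := by
          have : x ≠ 0 := by linarith
          rw [hQ, mul_pow, mul_pow, mul_pow]; field_simp
        _ ≤ _ := by gcongr
    rw [hQ] at this
    exact_mod_cast this
  -- pigeonhole
  let s : Finset (ℤ × (Fin ℓ → Fin d → ℤ)) :=
    Finset.Icc (1:ℤ) M ×ˢ Fintype.piFinset (fun _ : Fin ℓ => A)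
  let t : Finset (Fin ℓ → Fin d → ℤ) :=
    Fintype.piFinset fun _ => Fintype.piFinset fun _ => Finset.Icc (-(B * N) : ℤ) ((B + 1) * N)
  let f : ℤ × (Fin ℓ → Fin d → ℤ) → (Fin ℓ → Fin d → ℤ) :=
    fun q j => q.2 j + (P j).eval q.1 • v j
  have hst : t.card < s.card := by
    have hs : s.card = M * A.card ^ ℓ := by simp [s, Finset.card_product]
    have ht : t.card ≤ (((2 * B + 2) * N) ^ d) ^ ℓ := by
      simp only [t, Fintype.card_piFinset, Finset.prod_const, Finset.card_univ, Fintype.card_fin,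
        Int.card_Icc]
      gcongr
      have : (1:ℤ) ≤ N := by exact_mod_cast hN
      rw [Int.toNat_le]
      push_cast
      linarith
    omega
  have hmaps : ∀ q ∈ s, f q ∈ t := by
    rintro ⟨r, a⟩ hq
    simp only [s, Finset.mem_product, Finset.mem_Icc, Fintype.mem_piFinset] at hq
    obtain ⟨⟨hr1, hr2⟩, ha⟩ := hq
    simp only [t, f, Fintype.mem_piFinset]
    intro j i
    have h1 := hB r hr1 j i
    have h2 : r ^ k ≤ N := by
      calc r ^ k ≤ (M:ℤ) ^ k := by gcongr
        _ ≤ N := by exact_mod_cast hMk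
    have h3 : (B:ℤ) * r ^ k ≤ B * N := by gcongr
    have h4 := Finset.mem_Icc.1 (hA _ (ha j) i)
    have h5 := abs_le.1 (h1.trans h3)
    simp only [Pi.add_apply, Pi.smul_apply, smul_eq_mul, Finset.mem_Icc]
    constructor <;> linarith [h5.1, h5.2, h4.1, h4.2]
  obtain ⟨⟨r, a⟩, hq, ⟨r', a'⟩, hq', hne, heq⟩ :=
    Finset.exists_ne_map_eq_of_card_lt_of_maps_to hst hmaps
  simp only [s, Finset.mem_product, Finset.mem_Icc, Fintype.mem_piFinset] at hq hq'
  have heq' : ∀ j, a j + (P j).eval r • v j = a' j + (P j).eval r' • v j := fun j => congrFun heq j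
  refine ⟨r, r', by linarith [hq.1.1], by linarith [hq'.1.1], ?_, fun j =>
    ⟨a' j, hq'.2 j, a j, hq.2 j, ?_⟩⟩
  · rintro rfl
    exact hne (by congr 1; funext j; exact add_right_cancel (heq' j))
  · rw [sub_smul, sub_eq_sub_iff_add_eq_add, ← heq' j, add_comm]
end

section
/- Let d ≥ 1, ℓ ≥ 1 be integers and let Q_{ij}, for 1 ≤ i ≤ d and 1 ≤ j ≤ ℓ, be a collection of ℓd polynomials with integer coefficients, and let k = max over all i, j of deg Q_{ij}, with k ≥ 1. Then there exist a constant C > 0 and a threshold N₀ (both depending on the Q_{ij}) such that for every integer N ≥ N₀ and every set A ⊆ [1,N]^d with |A|/N^d ≥ C · N^(−1/(ℓk)), there exist positive integers r' ≠ r'' such that for every 1 ≤ j ≤ ℓ the vector Σ_{i=1}^d (Q_{ij}(r') − Q_{ij}(r''))·e_i belongs to A − A. -/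
/-- A uniform polynomial growth bound. -/
theorem poly_growth_bound (p : Polynomial ℤ) (k : ℕ) (hp : p.natDegree ≤ k) (r : ℤ) (hr : 1 ≤ r) :
    |p.eval r| ≤ (∑ m ∈ Finset.range (p.natDegree + 1), |p.coeff m|) * r ^ k := by
  rw [Polynomial.eval_eq_sum_range, Finset.sum_mul]
  refine (Finset.abs_sum_le_sum_abs _ _).trans (Finset.sum_le_sum fun m hm => ?_)
  rw [abs_mul, abs_of_pos (show 0 < r ^ m by positivity)]
  have : m ≤ k := by
    have := Finset.mem_range.1 hm
    omega
  exact mul_le_mul_of_nonneg_left (pow_le_pow_right₀ hr this) (abs_nonneg _)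

theorem exists_root_approx (B k N : ℕ) (hB : 1 ≤ B) (hk : 1 ≤ k) (hN : B ≤ N) :
    ∃ R : ℕ, 1 ≤ R ∧ B * R ^ k ≤ N ∧ N < B * (R + 1) ^ k := by
  have h1 : B * 1 ^ k ≤ N := by simpa using hN
  refine ⟨Nat.findGreatest (fun R => B * R ^ k ≤ N) N, ?_, ?_, ?_⟩
  · exact Nat.le_findGreatest (P := fun R => B * R ^ k ≤ N) (by omega) h1
  · exact Nat.findGreatest_spec (P := fun R => B * R ^ k ≤ N) (m := 1) (by omega) h1
  · by_contra! h
    have hle : Nat.findGreatest (fun R => B * R ^ k ≤ N) N + 1 ≤ N := by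
      refine le_trans ?_ h
      calc _ ≤ (Nat.findGreatest (fun R => B * R ^ k ≤ N) N + 1) ^ k := Nat.le_self_pow (by omega) _
        _ ≤ _ := Nat.le_mul_of_pos_left _ (by omega)
    have := Nat.le_findGreatest (P := fun R => B * R ^ k ≤ N) hle h
    omega

/-- Theorem 3.3: given a collection `Q_{ij}` of `ℓd` integer polynomials with
`k = max deg Q_{ij} ≥ 1`, there are `C > 0` and a threshold `N₀` such that for
`N ≥ N₀` any `A ⊆ [1,N]^d` with `|A|/N^d ≥ C·N^(-1/(ℓk))` contains, for each `j`,
the vector `Σ_i (Q_{ij}(r') - Q_{ij}(r''))·e_i` in `A - A`, for some distinct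
positive integers `r', r''`. -/
theorem multidim_poly_configuration_in_difference_set
    (d ℓ k : ℕ) (hd : 1 ≤ d) (hℓ : 1 ≤ ℓ) (hk : 1 ≤ k)
    (Q : Fin d → Fin ℓ → Polynomial ℤ)
    (hk_ub : ∀ i j, (Q i j).natDegree ≤ k)
    (hk_mem : ∃ i j, (Q i j).natDegree = k) :
    ∃ C : ℝ, 0 < C ∧ ∃ N₀ : ℕ,
      ∀ N : ℕ, N₀ ≤ N → ∀ A : Finset (Fin d → ℤ),
        (∀ x ∈ A, ∀ i : Fin d, x i ∈ Finset.Icc (1 : ℤ) (N : ℤ)) →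
        C * (N : ℝ) ^ (-(1 / ((ℓ : ℝ) * k))) ≤ (A.card : ℝ) / (N : ℝ) ^ d →
        ∃ r' r'' : ℤ, 0 < r' ∧ 0 < r'' ∧ r' ≠ r'' ∧
          ∀ j : Fin ℓ, ∃ a ∈ A, ∃ a' ∈ A,
            a - a' = fun i : Fin d => (Q i j).eval r' - (Q i j).eval r'' := by
  classical
  obtain ⟨B, hB1, hB⟩ : ∃ B : ℕ, 1 ≤ B ∧ ∀ i j (r : ℤ), 1 ≤ r →
      |(Q i j).eval r| ≤ (B : ℤ) * r ^ k := by
    let c : Fin d → Fin ℓ → ℤ := fun i j =>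
      ∑ m ∈ Finset.range ((Q i j).natDegree + 1), |(Q i j).coeff m|
    have hc : ∀ i j, 0 ≤ c i j := fun i j => Finset.sum_nonneg fun _ _ => abs_nonneg _
    have hs : 0 ≤ ∑ i, ∑ j, c i j :=
      Finset.sum_nonneg fun i _ => Finset.sum_nonneg fun j _ => hc i j
    refine ⟨(1 + ∑ i, ∑ j, c i j).toNat, by omega, fun i j r hr => ?_⟩
    rw [Int.toNat_of_nonneg (by omega)]
    refine (poly_growth_bound _ k (hk_ub i j) r hr).trans ?_
    refine mul_le_mul_of_nonneg_right ?_ (by positivity)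
    have h1 : c i j ≤ ∑ j, c i j :=
      Finset.single_le_sum (f := fun j => c i j) (fun j _ => hc i j) (Finset.mem_univ j)
    have h2 : ∑ j, c i j ≤ ∑ i, ∑ j, c i j :=
      Finset.single_le_sum (f := fun i => ∑ j, c i j)
        (fun i _ => Finset.sum_nonneg fun j _ => hc i j) (Finset.mem_univ i)
    change c i j ≤ _
    omega
  refine ⟨2 * B * 3 ^ d, by positivity, B, fun N hN A hA hdens => ?_⟩
  obtain ⟨R, hR1, hRN, hNR⟩ := exists_root_approx B k N hB1 hk hN
  have hNpos : 0 < N := by omega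
  have hNr : (0 : ℝ) < N := by exact_mod_cast hNpos
  have hBr : (1 : ℝ) ≤ B := by exact_mod_cast hB1
  have hRr : (1 : ℝ) ≤ R := by exact_mod_cast hR1
  -- the key inequality
  have key : (3 * N) ^ (d * ℓ) < R * A.card ^ ℓ := by
    set δ : ℝ := (N : ℝ) ^ (-(1 / ((ℓ : ℝ) * k))) with hδ
    have hδ0 : 0 < δ := Real.rpow_pos_of_pos hNr _
    have hδN : δ ^ (ℓ * k) * N = 1 := by
      have hlk : ((ℓ : ℝ) * k) ≠ 0 := by positivity
      rw [hδ, ← Real.rpow_natCast, ← Real.rpow_mul hNr.le]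
      push_cast
      rw [neg_mul, one_div_mul_cancel hlk, Real.rpow_neg_one, inv_mul_cancel₀ hNr.ne']
    have h1 : 1 < R * δ ^ ℓ * (2 * B) := by
      refine lt_of_pow_lt_pow_left₀ k (by positivity) ?_
      have e : (R * δ ^ ℓ * (2 * B)) ^ k = (2 * R) ^ k * (B : ℝ) ^ k * δ ^ (ℓ * k) := by
        rw [pow_mul]; simp only [mul_pow]; ring
      have hb : (B : ℝ) ≤ (B : ℝ) ^ k := le_self_pow₀ hBr (by omega)
      have h2 : ((R : ℝ) + 1) ^ k ≤ (2 * R) ^ k := by gcongr; linarith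
      have h3 : (N : ℝ) < B * ((R : ℝ) + 1) ^ k := by exact_mod_cast hNR
      have h4 : (N : ℝ) < (2 * R) ^ k * (B : ℝ) ^ k := by
        refine h3.trans_le ?_
        rw [mul_comm]
        gcongr
      rw [e, one_pow]
      calc (1 : ℝ) = N * δ ^ (ℓ * k) := by rw [mul_comm, hδN]
        _ < _ := by gcongr
    have h5 : 2 * B * 3 ^ d * δ * (N : ℝ) ^ d ≤ A.card := by
      rwa [le_div_iff₀ (by positivity)] at hdens
    have h6 : (2 * B * 3 ^ d * δ * (N : ℝ) ^ d) ^ ℓ ≤ (A.card : ℝ) ^ ℓ := by gcongr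
    have hb : (2 * B : ℝ) ≤ (2 * B : ℝ) ^ ℓ := le_self_pow₀ (by linarith) (by omega)
    have h7 : ((3 * N : ℝ)) ^ (d * ℓ) < R * (A.card : ℝ) ^ ℓ := by
      calc ((3 * N : ℝ)) ^ (d * ℓ) = 1 * (3 * N : ℝ) ^ (d * ℓ) := by ring
        _ < (R * δ ^ ℓ * (2 * B)) * (3 * N : ℝ) ^ (d * ℓ) := by gcongr
        _ ≤ (R * δ ^ ℓ * (2 * B) ^ ℓ) * (3 * N : ℝ) ^ (d * ℓ) := by gcongr
        _ = R * (2 * B * 3 ^ d * δ * (N : ℝ) ^ d) ^ ℓ := by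
          rw [pow_mul]; simp only [mul_pow]; ring
        _ ≤ _ := by gcongr
    exact_mod_cast h7
  -- pigeonhole on translates of the product set
  let S : Finset (ℤ × (Fin ℓ → Fin d → ℤ)) :=
    Finset.Icc (1 : ℤ) R ×ˢ Fintype.piFinset (fun _ : Fin ℓ => A)
  let T : Finset (Fin ℓ → Fin d → ℤ) :=
    Fintype.piFinset fun _ => Fintype.piFinset fun _ => Finset.Icc (1 - (N : ℤ)) (2 * N)
  let f : ℤ × (Fin ℓ → Fin d → ℤ) → (Fin ℓ → Fin d → ℤ) :=
    fun p j i => p.2 j i + (Q i j).eval p.1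
  have hcard : T.card < S.card := by
    have hS : S.card = R * A.card ^ ℓ := by simp [S]
    have hT : T.card = (3 * N) ^ (d * ℓ) := by
      have : ((2 * N + 1 - (1 - N) : ℤ)).toNat = 3 * N := by omega
      simp [T, this, pow_mul]
    omega
  have hmaps : ∀ p ∈ S, f p ∈ T := by
    rintro ⟨r, a⟩ hp
    simp only [S, Finset.mem_product, Finset.mem_Icc, Fintype.mem_piFinset] at hp
    obtain ⟨⟨hr1, hr2⟩, ha⟩ := hp
    simp only [T, Fintype.mem_piFinset, f, Finset.mem_Icc]
    intro j i
    have h1 := Finset.mem_Icc.1 (hA _ (ha j) i)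
    have h2 := hB i j r hr1
    have h3 : (B : ℤ) * r ^ k ≤ N := by
      calc (B : ℤ) * r ^ k ≤ B * (R : ℤ) ^ k := by gcongr
        _ ≤ N := by exact_mod_cast hRN
    have h4 := abs_le.1 (h2.trans h3)
    omega
  obtain ⟨⟨r, a⟩, hp, ⟨r', a'⟩, hp', hne, heq⟩ :=
    Finset.exists_ne_map_eq_of_card_lt_of_maps_to hcard hmaps
  simp only [S, Finset.mem_product, Finset.mem_Icc, Fintype.mem_piFinset] at hp hp'
  have hval : ∀ j i, a j i + (Q i j).eval r = a' j i + (Q i j).eval r' :=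
    fun j i => congrFun (congrFun heq j) i
  refine ⟨r, r', by omega, by omega, ?_, fun j => ⟨a' j, hp'.2 j, a j, hp.2 j, ?_⟩⟩
  · rintro rfl
    apply hne
    refine Prod.ext rfl ?_
    funext j i
    have := hval j i
    simp only
    omega
  · funext i
    have := hval j i
    simp only [Pi.sub_apply]
    omega
end

section
/- Let d ≥ 1, ℓ ≥ 1 be integers and let Q_{ij}, for 1 ≤ i ≤ d and 1 ≤ j ≤ ℓ, be a collection of ℓd polynomials with integer coefficients; let k = max over all i, j of deg Q_{ij}, with k ≥ 1, and let t > 0 be the maximum of the absolute values of the leading coefficients among those Q_{ij} of degree exactly k. Then there exists a threshold N₀ (depending on the Q_{ij}) such that for every integer N ≥ N₀ and every set A ⊆ [1,N]^d with |A|/N^d ≥ 2^(1/ℓ) · 4^d · t^(1/(ℓk)) · N^(−1/(ℓk)), there exist positive integers r' ≠ r'' such that for every 1 ≤ j ≤ ℓ the vector Σ_{i=1}^d (Q_{ij}(r') − Q_{ij}(r''))·e_i belongs to A − A. -/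
lemma poly_eval_bound_aux (p : Polynomial ℤ) (k : ℕ) (hk : 1 ≤ k) (hp : p.natDegree ≤ k) (t : ℤ)
    (ht : |p.coeff k| ≤ t) (r R : ℤ) (hr : 0 < r) (hrR : r ≤ R) :
    |p.eval r| ≤ t * R ^ k + (∑ i ∈ Finset.range k, |p.coeff i|) * R ^ (k - 1) := by
  rw [Polynomial.eval_eq_sum_range' (Nat.lt_succ_of_le hp), Finset.sum_range_succ]
  have h1 : |p.coeff k * r ^ k| ≤ t * R ^ k := by
    rw [abs_mul, abs_of_pos (pow_pos hr k)]
    have : r ^ k ≤ R ^ k := pow_le_pow_left₀ hr.le hrR k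
    exact mul_le_mul ht this (pow_pos hr k).le ((abs_nonneg _).trans ht)
  have h2 : |∑ i ∈ Finset.range k, p.coeff i * r ^ i|
      ≤ (∑ i ∈ Finset.range k, |p.coeff i|) * R ^ (k - 1) := by
    rw [Finset.sum_mul]
    refine (Finset.abs_sum_le_sum_abs _ _).trans (Finset.sum_le_sum fun i hi => ?_)
    rw [abs_mul, abs_of_pos (pow_pos hr i)]
    have h3 : r ^ i ≤ R ^ i := pow_le_pow_left₀ hr.le hrR i
    have h4 : R ^ i ≤ R ^ (k - 1) :=
      pow_le_pow_right₀ (by omega) (by have := Finset.mem_range.1 hi; omega)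
    exact mul_le_mul_of_nonneg_left (h3.trans h4) (abs_nonneg _)
  exact (abs_add_le _ _).trans (by linarith)

lemma pigeon_aux (d ℓ : ℕ) (q : Fin d → Fin ℓ → ℤ → ℤ) (N R M : ℕ) (A : Finset (Fin d → ℤ))
    (hA : ∀ x ∈ A, ∀ i : Fin d, x i ∈ Finset.Icc (1 : ℤ) (N : ℤ))
    (hq : ∀ i j r, 0 < r → r ≤ (R : ℤ) → |q i j r| ≤ M)
    (hcard : (N + 2 * M) ^ (d * ℓ) < R * A.card ^ ℓ) :
    ∃ r' r'' : ℤ, 0 < r' ∧ 0 < r'' ∧ r' ≠ r'' ∧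
        ∀ j : Fin ℓ, ∃ a ∈ A, ∃ a' ∈ A,
          a - a' = fun i : Fin d => q i j r' - q i j r'' := by
  classical
  let S : Finset (ℤ × (Fin ℓ → Fin d → ℤ)) :=
    Finset.Icc (1 : ℤ) R ×ˢ Fintype.piFinset (fun _ : Fin ℓ => A)
  let T : Finset (Fin ℓ → Fin d → ℤ) :=
    Fintype.piFinset fun _ => Fintype.piFinset fun _ => Finset.Icc (1 - M : ℤ) (N + M)
  let f : ℤ × (Fin ℓ → Fin d → ℤ) → (Fin ℓ → Fin d → ℤ) := fun p j i => p.2 j i + q i j p.1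
  have hT : T.card = (N + 2 * M) ^ (d * ℓ) := by
    have h : (Finset.Icc (1 - M : ℤ) (N + M)).card = N + 2 * M := by
      rw [Int.card_Icc]; omega
    simp [T, Fintype.card_piFinset, -Int.card_Icc, h, pow_mul]
  have hS : S.card = R * A.card ^ ℓ := by
    simp [S, Fintype.card_piFinset]
  have hmap : ∀ p ∈ S, f p ∈ T := by
    intro p hp
    simp only [S, Finset.mem_product, Finset.mem_Icc, Fintype.mem_piFinset] at hp
    simp only [T, Fintype.mem_piFinset, Finset.mem_Icc, f]
    intro j i
    have h1 := Finset.mem_Icc.1 (hA _ (hp.2 j) i)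
    have h2 := abs_le.1 (hq i j p.1 (by omega) hp.1.2)
    omega
  obtain ⟨x, hx, y, hy, hxy, hf⟩ :=
    Finset.exists_ne_map_eq_of_card_lt_of_maps_to (by rw [hT, hS]; exact hcard) hmap
  simp only [S, Finset.mem_product, Finset.mem_Icc, Fintype.mem_piFinset] at hx hy
  have hf' : ∀ j i, x.2 j i + q i j x.1 = y.2 j i + q i j y.1 :=
    fun j i => congrFun (congrFun hf j) i
  refine ⟨x.1, y.1, by omega, by omega, ?_, ?_⟩
  · intro h
    apply hxy
    refine Prod.ext h ?_
    funext j i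
    have := hf' j i
    rw [h] at this
    omega
  · intro j
    refine ⟨y.2 j, hy.2 j, x.2 j, hx.2 j, ?_⟩
    funext i
    have := hf' j i
    simp only [Pi.sub_apply]
    omega

lemma real_aux (d ℓ k N a R : ℕ) (hℓ : 1 ≤ ℓ) (hk : 1 ≤ k) (t : ℝ) (ht : 0 < t) (hN : 0 < N)
    (hR : ((N : ℝ) / t) ^ (1 / (k : ℝ)) < 2 * R)
    (h : (2 : ℝ) ^ (1 / (ℓ : ℝ)) * 4 ^ d * t ^ (1 / ((ℓ : ℝ) * k))
          * (N : ℝ) ^ (-(1 / ((ℓ : ℝ) * k)))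
        ≤ (a : ℝ) / (N : ℝ) ^ d) :
    (4 * N) ^ (d * ℓ) < R * a ^ ℓ := by
  have hN' : (0 : ℝ) < N := by exact_mod_cast hN
  have hℓ' : (ℓ : ℝ) ≠ 0 := by positivity
  have hk' : (k : ℝ) ≠ 0 := by positivity
  set x := ((N : ℝ) / t) ^ (1 / (k : ℝ)) with hx
  have hxpos : 0 < x := by positivity
  have e1 : ((2 : ℝ) ^ (1 / (ℓ : ℝ))) ^ ℓ = 2 := by
    rw [← Real.rpow_natCast, ← Real.rpow_mul (by norm_num)]; field_simp; simp
  have e2 : (t ^ (1 / ((ℓ : ℝ) * k)) * (N : ℝ) ^ (-(1 / ((ℓ : ℝ) * k)))) ^ ℓ = x⁻¹ := by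
    rw [Real.rpow_neg hN'.le, ← div_eq_mul_inv, ← Real.div_rpow ht.le hN'.le,
      ← Real.rpow_natCast, ← Real.rpow_mul (by positivity), hx, ← Real.inv_rpow (by positivity),
      inv_div]
    congr 1
    field_simp
  have h1 := pow_le_pow_left₀ (by positivity) h ℓ
  rw [mul_assoc ((2 : ℝ) ^ (1 / (ℓ : ℝ)) * 4 ^ d), mul_pow, mul_pow, e1, e2, div_pow,
    le_div_iff₀ (by positivity), ← pow_mul, ← pow_mul] at h1
  have h2 : ((4 * N : ℝ)) ^ (d * ℓ) < R * a ^ ℓ := by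
    have h3 : 1 < 2 * R * x⁻¹ := by
      rw [← div_eq_mul_inv, lt_div_iff₀ hxpos]; linarith
    have h4 : (0 : ℝ) < (4 * N : ℝ) ^ (d * ℓ) := by positivity
    calc ((4 * N : ℝ)) ^ (d * ℓ) < (4 * N : ℝ) ^ (d * ℓ) * (2 * R * x⁻¹) :=
          lt_mul_of_one_lt_right h4 h3
      _ = R * (2 * 4 ^ (d * ℓ) * x⁻¹ * N ^ (d * ℓ)) := by rw [mul_pow]; ring
      _ ≤ R * a ^ ℓ := mul_le_mul_of_nonneg_left h1 (by positivity)
  exact_mod_cast h2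

/-- Theorem 3.3 with the explicit constant `C = 2^(1/ℓ)·4^d·t^(1/(ℓk))`, where `t`
is the maximal absolute value of the leading coefficients of those `Q_{ij}` of
maximal degree `k`. -/
theorem multidim_poly_configuration_in_difference_set_explicit
    (d ℓ k : ℕ) (hd : 1 ≤ d) (hℓ : 1 ≤ ℓ) (hk : 1 ≤ k)
    (Q : Fin d → Fin ℓ → Polynomial ℤ)
    (hk_ub : ∀ i j, (Q i j).natDegree ≤ k)
    (hk_mem : ∃ i j, (Q i j).natDegree = k)
    (t : ℤ) (ht_pos : 0 < t)
    (ht_ub : ∀ i j, (Q i j).natDegree = k → |(Q i j).leadingCoeff| ≤ t)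
    (ht_mem : ∃ i j, (Q i j).natDegree = k ∧ |(Q i j).leadingCoeff| = t) :
    ∃ N₀ : ℕ, ∀ N : ℕ, N₀ ≤ N → ∀ A : Finset (Fin d → ℤ),
      (∀ x ∈ A, ∀ i : Fin d, x i ∈ Finset.Icc (1 : ℤ) (N : ℤ)) →
      (2 : ℝ) ^ (1 / (ℓ : ℝ)) * 4 ^ d * (t : ℝ) ^ (1 / ((ℓ : ℝ) * k))
          * (N : ℝ) ^ (-(1 / ((ℓ : ℝ) * k)))
        ≤ (A.card : ℝ) / (N : ℝ) ^ d →
      ∃ r' r'' : ℤ, 0 < r' ∧ 0 < r'' ∧ r' ≠ r'' ∧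
        ∀ j : Fin ℓ, ∃ a ∈ A, ∃ a' ∈ A,
          a - a' = fun i : Fin d => (Q i j).eval r' - (Q i j).eval r'' := by
  classical
  set C : ℤ := ∑ i, ∑ j, ∑ m ∈ Finset.range k, |(Q i j).coeff m| with hC
  have hCle : ∀ i j, ∑ m ∈ Finset.range k, |(Q i j).coeff m| ≤ C := by
    intro i j
    have h0 : ∀ i j, 0 ≤ ∑ m ∈ Finset.range k, |(Q i j).coeff m| :=
      fun i j => Finset.sum_nonneg fun _ _ => abs_nonneg _
    exact (Finset.single_le_sum (f := fun j => ∑ m ∈ Finset.range k, |(Q i j).coeff m|)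
      (fun j _ => h0 i j) (Finset.mem_univ j)).trans
      (Finset.single_le_sum (f := fun i => ∑ j, ∑ m ∈ Finset.range k, |(Q i j).coeff m|)
      (fun i _ => Finset.sum_nonneg fun j _ => h0 i j) (Finset.mem_univ i))
  have hC0 : 0 ≤ C := by
    obtain ⟨i, j, _⟩ := hk_mem
    exact (Finset.sum_nonneg fun _ _ => abs_nonneg _).trans (hCle i j)
  have hcoef : ∀ i j, |(Q i j).coeff k| ≤ t := by
    intro i j
    rcases (hk_ub i j).lt_or_eq with h | h
    · rw [Polynomial.coeff_eq_zero_of_natDegree_lt h]; simpa using ht_pos.le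
    · have := ht_ub i j h
      rwa [Polynomial.leadingCoeff, h] at this
  clear_value C
  lift C to ℕ using hC0
  lift t to ℕ using ht_pos.le
  have htn : 0 < t := by exact_mod_cast ht_pos
  have htR : (0 : ℝ) < t := by exact_mod_cast htn
  refine ⟨t * (2 * C + 1) ^ k, fun N hN A hA hdens => ?_⟩
  have hNpos : 0 < N := lt_of_lt_of_le (by positivity) hN
  have hkR : (k : ℝ) ≠ 0 := by positivity
  set x := ((N : ℝ) / t) ^ (1 / (k : ℝ)) with hx
  have hx0 : 0 ≤ x := by positivity
  have hxk : x ^ k = N / t := by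
    rw [hx, ← Real.rpow_natCast, ← Real.rpow_mul (by positivity),
      one_div_mul_cancel hkR, Real.rpow_one]
  set R := ⌊x⌋₊ with hRdef
  have hRx : (R : ℝ) ≤ x := Nat.floor_le hx0
  have hxR : x < R + 1 := Nat.lt_floor_add_one x
  have hRC : 2 * C + 1 ≤ R := by
    apply Nat.le_floor
    refine le_of_pow_le_pow_left₀ (by omega : k ≠ 0) hx0 ?_
    rw [hxk, le_div_iff₀ htR]
    have : (2 * C + 1) ^ k * t ≤ N := by rw [mul_comm]; exact hN
    exact_mod_cast this
  have hRk : t * R ^ k ≤ N := by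
    have h1 : (R : ℝ) ^ k ≤ N / t := hxk ▸ pow_le_pow_left₀ (by positivity) hRx k
    rw [le_div_iff₀ htR, mul_comm] at h1
    exact_mod_cast h1
  have hR2 : x < 2 * R := by
    have : (1 : ℝ) ≤ R := by exact_mod_cast (by omega : 1 ≤ R)
    linarith
  have hCR : 2 * (C * R ^ (k - 1)) ≤ N := by
    calc 2 * (C * R ^ (k - 1)) = (2 * C) * R ^ (k - 1) := by ring
      _ ≤ R * R ^ (k - 1) := Nat.mul_le_mul_right _ (by omega)
      _ = R ^ k := by rw [← pow_succ']; congr 1; omega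
      _ ≤ t * R ^ k := Nat.le_mul_of_pos_left _ htn
      _ ≤ N := hRk
  have hmain := real_aux d ℓ k N A.card R hℓ hk t htR hNpos hR2 (by exact_mod_cast hdens)
  refine pigeon_aux d ℓ (fun i j r => (Q i j).eval r) N R (N + C * R ^ (k - 1)) A hA ?_ ?_
  · intro i j r hr hrR
    refine (poly_eval_bound_aux (Q i j) k hk (hk_ub i j) t (hcoef i j) r R hr hrR).trans ?_
    push_cast
    have h1 : ((t : ℤ) * R ^ k) ≤ N := by exact_mod_cast hRk
    have h2 := mul_le_mul_of_nonneg_right (hCle i j) (by positivity : (0 : ℤ) ≤ (R : ℤ) ^ (k - 1))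
    linarith
  · exact lt_of_le_of_lt (Nat.pow_le_pow_left (by omega) _) hmain
end

section
/- Let N ≥ 1 be an integer and let m ≥ 3 be an odd positive integer. If A, B ⊆ [1,N] satisfy |A||B|/N² ≥ 8 · N^(−2/(m−1)), then A + B contains an arithmetic progression of length at least m; that is, there exist an integer a and a nonzero integer q such that a + j·q ∈ A + B for every 0 ≤ j ≤ m − 1. -/
lemma diff_set_aux (N : ℕ) (k : ℕ) (hk : 1 ≤ k) (D : Finset ℤ)
    (hD : D ⊆ Finset.Icc (1 : ℤ) (N : ℤ))
    (hcard : (∑ i : Fin k, ((i : ℕ) + 1)) * N ^ (k - 1) < D.card ^ k) :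
    ∃ q : ℤ, q ≠ 0 ∧ ∀ i : Fin k, ∃ x ∈ D, ∃ y ∈ D, x - y = ((i : ℤ) + 1) * q := by
  classical
  haveI : Nonempty (Fin k) := ⟨⟨0, hk⟩⟩
  have key : ∀ x : Fin k → ℤ, ∃ t : ℤ, (∀ j, x j ∈ D) →
      (∀ j, x j - t * ((j : ℤ) + 1) ∈ Finset.Icc (1 : ℤ) N) ∧
      ∃ j : Fin k, x j - t * ((j : ℤ) + 1) ≤ (j : ℤ) + 1 := by
    intro x
    obtain ⟨j0, -, hj0⟩ := Finset.exists_min_image Finset.univ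
      (fun j : Fin k => (x j - 1) / ((j : ℤ) + 1)) Finset.univ_nonempty
    refine ⟨(x j0 - 1) / ((j0 : ℤ) + 1), fun hx => ⟨fun j => ?_, j0, ?_⟩⟩
    · have h1 := Finset.mem_Icc.1 (hD (hx j))
      have h0 := Finset.mem_Icc.1 (hD (hx j0))
      have ht : 0 ≤ (x j0 - 1) / ((j0 : ℤ) + 1) :=
        Int.ediv_nonneg (by linarith) (by positivity)
      have hle := hj0 j (Finset.mem_univ _)
      have hp : (0 : ℤ) < (j : ℤ) + 1 := by positivity
      have h2 := (Int.le_ediv_iff_mul_le hp).1 hle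
      have h3 := mul_nonneg ht hp.le
      rw [Finset.mem_Icc]
      constructor <;> linarith
    · have hp : (0 : ℤ) < (j0 : ℤ) + 1 := by positivity
      have := Int.lt_ediv_add_one_mul_self (x j0 - 1) hp
      linarith
  choose t ht using key
  let S : Finset (Fin k → ℤ) := Finset.univ.biUnion fun j : Fin k =>
    Fintype.piFinset (Function.update (fun _ : Fin k => Finset.Icc (1 : ℤ) N) j
      (Finset.Icc (1 : ℤ) ((j : ℤ) + 1)))
  have hS : S.card ≤ (∑ i : Fin k, ((i : ℕ) + 1)) * N ^ (k - 1) := by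
    refine Finset.card_biUnion_le.trans ?_
    rw [Finset.sum_mul]
    refine Finset.sum_le_sum fun j _ => ?_
    rw [Fintype.card_piFinset]
    have : ∀ i, (Function.update (fun _ : Fin k => Finset.Icc (1 : ℤ) N) j
      (Finset.Icc (1 : ℤ) ((j : ℤ) + 1)) i).card =
      Function.update (fun _ : Fin k => N) j ((j : ℕ) + 1) i := by
      intro i
      by_cases h : i = j
      · subst h; simp
      · simp [h]
    rw [Finset.prod_congr rfl (fun i _ => this i),
      Finset.prod_update_of_mem (Finset.mem_univ j)]
    simp [Finset.card_sdiff]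
  have hlt : S.card < (Fintype.piFinset (fun _ : Fin k => D)).card := by
    simpa using hS.trans_lt hcard
  obtain ⟨x, hx, y, hy, hne, hxy⟩ := Finset.exists_ne_map_eq_of_card_lt_of_maps_to hlt
    (f := fun x j => x j - t x * ((j : ℤ) + 1)) (by
      intro x hx
      have hx' : ∀ j, x j ∈ D := by simpa using hx
      obtain ⟨h1, j, hj⟩ := ht x hx'
      refine Finset.mem_coe.2 (Finset.mem_biUnion.2 ⟨j, Finset.mem_univ _, ?_⟩)
      rw [Fintype.mem_piFinset]
      intro i
      by_cases h : i = j
      · subst h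
        rw [Function.update_self, Finset.mem_Icc]
        exact ⟨(Finset.mem_Icc.1 (h1 i)).1, hj⟩
      · rw [Function.update_of_ne h]
        exact h1 i)
  rw [Fintype.mem_piFinset] at hx hy
  have hxy' : ∀ j, x j - t x * ((j : ℤ) + 1) = y j - t y * ((j : ℤ) + 1) :=
    fun j => congrFun hxy j
  refine ⟨t x - t y, fun h => hne ?_, fun i => ⟨x i, hx i, y i, hy i, ?_⟩⟩
  · funext j
    have := hxy' j
    rw [sub_eq_zero.1 h] at this
    linarith
  · linarith [hxy' i]

lemma sum_aux (k : ℕ) : ∑ i : Fin k, ((i : ℕ) + 1) < 4 ^ k := by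
  rw [Fin.sum_univ_eq_sum_range (fun i => i + 1)]
  induction k with
  | zero => simp
  | succ n ih =>
    rw [Finset.sum_range_succ, pow_succ]
    have : n < 4 ^ n := Nat.lt_pow_self (by norm_num)
    omega

/-- Theorem A (Croot–Ruzsa–Schoen, with constant 8): if `m ≥ 3` is odd and
`A, B ⊆ [1,N]` with `|A||B|/N² ≥ 8·N^(-2/(m-1))`, then `A + B` contains an
arithmetic progression of length `m`. -/
theorem ap_in_sparse_sumset
    (N : ℕ) (hN : 1 ≤ N) (m : ℕ) (hm : 3 ≤ m) (hmodd : Odd m)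
    (A B : Finset ℤ)
    (hA : A ⊆ Finset.Icc (1 : ℤ) (N : ℤ)) (hB : B ⊆ Finset.Icc (1 : ℤ) (N : ℤ))
    (hdens : 8 * (N : ℝ) ^ (-(2 / ((m : ℝ) - 1)))
        ≤ ((A.card : ℝ) * B.card) / (N : ℝ) ^ 2) :
    ∃ a q : ℤ, q ≠ 0 ∧ ∀ j : ℕ, j ≤ m - 1 →
      ∃ x ∈ A, ∃ y ∈ B, x + y = a + (j : ℤ) * q := by
  classical
  obtain ⟨k, rfl⟩ := hmodd
  have hk : 1 ≤ k := by omega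
  have hNR : (0 : ℝ) < N := by exact_mod_cast hN
  have hkR : (0 : ℝ) < k := by exact_mod_cast hk
  set c : ℝ := (N : ℝ) ^ (-(2 / (((2 * k + 1 : ℕ) : ℝ) - 1))) with hc
  have hc0 : 0 < c := Real.rpow_pos_of_pos hNR _
  have hck : c ^ k * N = 1 := by
    rw [hc, ← Real.rpow_natCast, ← Real.rpow_mul hNR.le]
    have : -(2 / (((2 * k + 1 : ℕ) : ℝ) - 1)) * (k : ℝ) = -1 := by
      push_cast
      field_simp
      ring
    rw [this, Real.rpow_neg_one]
    field_simp
  rw [le_div_iff₀ (by positivity)] at hdens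
  obtain ⟨n, -, hn⟩ := Finset.exists_le_card_fiber_of_nsmul_le_card_of_maps_to
    (s := A ×ˢ B) (t := Finset.Icc (1 : ℤ) (2 * N)) (f := fun p => p.1 + p.2)
    (b := 4 * c * N) (by
      intro p hp
      have hp' := Finset.mem_product.1 hp
      have h1 := Finset.mem_Icc.1 (hA hp'.1)
      have h2 := Finset.mem_Icc.1 (hB hp'.2)
      simp only [Finset.mem_Icc]
      constructor <;> linarith)
    (Finset.nonempty_Icc.2 (by omega)) (by
      have : (Finset.Icc (1 : ℤ) (2 * N)).card = 2 * N := by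
        rw [Int.card_Icc]; omega
      rw [this, nsmul_eq_mul, Finset.card_product]
      push_cast
      linarith)
  set D := A.filter (fun x => n - x ∈ B) with hDdef
  have hfib : ((A ×ˢ B).filter (fun p => p.1 + p.2 = n)).card ≤ D.card := by
    refine Finset.card_le_card_of_injOn Prod.fst ?_ ?_
    · intro p hp
      have hp := Finset.mem_filter.1 (Finset.mem_coe.1 hp)
      have hp' := Finset.mem_product.1 hp.1
      refine Finset.mem_coe.2 (Finset.mem_filter.2 ⟨hp'.1, ?_⟩)
      have : n - p.1 = p.2 := by linarith [hp.2]
      rw [this]; exact hp'.2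
    · intro p hp p' hp' h
      have h1 := (Finset.mem_filter.1 (Finset.mem_coe.1 hp)).2
      have h2 := (Finset.mem_filter.1 (Finset.mem_coe.1 hp')).2
      refine Prod.ext h ?_
      have : p.1 = p'.1 := h
      linarith
  have hDc : 4 * c * N ≤ (D.card : ℝ) := hn.trans (by exact_mod_cast hfib)
  have hpow : (4 : ℝ) ^ k * (N : ℝ) ^ (k - 1) ≤ (D.card : ℝ) ^ k := by
    calc (4 : ℝ) ^ k * (N : ℝ) ^ (k - 1)
        = 4 ^ k * (N : ℝ) ^ (k - 1) * (c ^ k * N) := by rw [hck, mul_one]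
      _ = (4 * c * N) ^ k := by
          obtain ⟨l, rfl⟩ : ∃ l, k = l + 1 := ⟨k - 1, by omega⟩
          rw [Nat.add_sub_cancel, mul_pow, mul_pow, pow_succ (N : ℝ) l]
          ring
      _ ≤ _ := pow_le_pow_left₀ (by positivity) hDc k
  have hpowN : 4 ^ k * N ^ (k - 1) ≤ D.card ^ k := by exact_mod_cast hpow
  have hcard : (∑ i : Fin k, ((i : ℕ) + 1)) * N ^ (k - 1) < D.card ^ k :=
    lt_of_lt_of_le (Nat.mul_lt_mul_of_pos_right (sum_aux k) (by positivity)) hpowN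
  obtain ⟨q, hq, hqD⟩ := diff_set_aux N k hk D ((Finset.filter_subset _ _).trans hA) hcard
  have hpos : ∀ i : ℕ, i ≤ k → ∃ x ∈ D, ∃ y ∈ D, x - y = (i : ℤ) * q := by
    intro i hi
    rcases i with _ | i
    · obtain ⟨x, hx, -⟩ := hqD ⟨0, hk⟩
      exact ⟨x, hx, x, hx, by simp⟩
    · obtain ⟨x, hx, y, hy, h⟩ := hqD ⟨i, hi⟩
      exact ⟨x, hx, y, hy, by push_cast; exact h⟩
  refine ⟨n - k * q, q, hq, fun j hj => ?_⟩
  rcases le_total k j with h | h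
  · obtain ⟨i, rfl⟩ := Nat.exists_eq_add_of_le h
    obtain ⟨x, hx, y, hy, hxy⟩ := hpos i (by omega)
    refine ⟨x, (Finset.mem_filter.1 hx).1, n - y, (Finset.mem_filter.1 hy).2, ?_⟩
    push_cast
    linarith
  · obtain ⟨i, rfl⟩ := Nat.exists_eq_add_of_le h
    obtain ⟨x, hx, y, hy, hxy⟩ := hpos i (by omega)
    refine ⟨y, (Finset.mem_filter.1 hy).1, n - x, (Finset.mem_filter.1 hx).2, ?_⟩
    push_cast
    linarith
end

section
/- Let d ≥ 1 and ℓ ≥ 1 be integers, let v_1, …, v_ℓ be vectors in ℤ^d, not all zero, and set s = max over 1 ≤ j ≤ ℓ and 1 ≤ i ≤ d of |⟨v_j, e_i⟩|. For every integer N ≥ s and every set A ⊆ [1,N]^d, there exists w = (w_1, …, w_ℓ) ∈ (ℤ^d)^ℓ such that the number of integers r ∈ [1, ⌊N/s⌋] satisfying r·v_j + w_j ∈ A for every 1 ≤ j ≤ ℓ is at least |A|^ℓ · ⌊N/s⌋ / (N^(dℓ) · ∏_{i=1}^d ∏_{j=1}^ℓ (1 + |⟨v_j, e_i⟩|/s)).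 -/
/-- The pigeonhole step in the proof of Theorem 1.1: with `s` the maximal absolute
value of a coordinate of the (not all zero) vectors `v j`, and `N ≥ s`, there is a
shift vector `w ∈ (ℤ^d)^ℓ` such that the number of `r ∈ [1, ⌊N/s⌋]` with
`r·v_j + w_j ∈ A` for all `j` is at least
`|A|^ℓ·⌊N/s⌋/(N^(dℓ)·∏_{i,j}(1 + |⟨v_j,e_i⟩|/s))`. -/
theorem exists_good_shift_vector_multidim
    (d ℓ : ℕ) (hd : 1 ≤ d) (hℓ : 1 ≤ ℓ) (v : Fin ℓ → (Fin d → ℤ))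
    (hv : ∃ j i, v j i ≠ 0)
    (s : ℤ) (hs_ub : ∀ j i, |v j i| ≤ s) (hs_mem : ∃ j i, |v j i| = s)
    (N : ℕ) (hN : s ≤ (N : ℤ)) (A : Finset (Fin d → ℤ))
    (hA : ∀ x ∈ A, ∀ i : Fin d, x i ∈ Finset.Icc (1 : ℤ) (N : ℤ)) :
    ∃ w : Fin ℓ → (Fin d → ℤ),
      (A.card : ℝ) ^ ℓ * (((N : ℤ) / s : ℤ) : ℝ) /
          ((N : ℝ) ^ (d * ℓ) * ∏ i : Fin d, ∏ j : Fin ℓ, (1 + |(v j i : ℝ)| / s))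
        ≤ (((Finset.Icc (1 : ℤ) ((N : ℤ) / s)).filter
            fun r => ∀ j : Fin ℓ, r • v j + w j ∈ A).card : ℝ) := by
  classical
  have hs : 0 < s := by
    obtain ⟨j, i, h⟩ := hv
    exact lt_of_lt_of_le (abs_pos.mpr h) (hs_ub j i)
  have hNpos : (0 : ℤ) < N := lt_of_lt_of_le hs hN
  set M : ℤ := (N : ℤ) / s with hM
  have hM0 : 0 ≤ M := Int.ediv_nonneg hNpos.le hs.le
  have hMs : M * s ≤ N := Int.ediv_mul_le _ hs.ne'
  let I : Fin ℓ → Fin d → Finset ℤ := fun j i =>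
    Finset.Icc (1 - M * max (v j i) 0) (N + M * max (-(v j i)) 0)
  let B : Finset (Fin ℓ → Fin d → ℤ) :=
    Fintype.piFinset fun j => Fintype.piFinset fun i => I j i
  have hsR : (0 : ℝ) < s := by exact_mod_cast hs
  have hNR : (0 : ℝ) < N := by exact_mod_cast hNpos
  have hIcard : ∀ j i, ((I j i).card : ℝ) ≤ N * (1 + |(v j i : ℝ)| / s) := by
    intro j i
    have hmm : max (v j i) 0 + max (-(v j i)) 0 = |v j i| := by
      rcases le_total 0 (v j i) with h | h
      · rw [max_eq_left h, max_eq_right (by linarith), abs_of_nonneg h]; ring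
      · rw [max_eq_right h, max_eq_left (by linarith), abs_of_nonpos h]; ring
    have h1 : ((I j i).card : ℤ) = N + M * |v j i| := by
      have h0 : 0 ≤ M * |v j i| := mul_nonneg hM0 (abs_nonneg _)
      rw [Int.card_Icc, ← hmm, Int.toNat_of_nonneg]
      · ring
      · rw [← hmm] at h0
        nlinarith
    have h2 : ((I j i).card : ℝ) = N + M * |(v j i : ℝ)| := by exact_mod_cast h1
    have h3 : (M : ℝ) ≤ N / s := by
      rw [le_div_iff₀ hsR]
      exact_mod_cast hMs
    rw [h2]
    calc (N : ℝ) + M * |(v j i : ℝ)| ≤ N + N / s * |(v j i : ℝ)| := by gcongr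
      _ = _ := by ring
  have hBcard : (B.card : ℝ) ≤
      (N : ℝ) ^ (d * ℓ) * ∏ i : Fin d, ∏ j : Fin ℓ, (1 + |(v j i : ℝ)| / s) := by
    have h1 : (B.card : ℝ) = ∏ j, ∏ i, ((I j i).card : ℝ) := by
      simp only [B, Fintype.card_piFinset]
      push_cast
      rfl
    rw [h1, Finset.prod_comm]
    calc ∏ i, ∏ j, ((I j i).card : ℝ)
        ≤ ∏ i : Fin d, ∏ j : Fin ℓ, (N * (1 + |(v j i : ℝ)| / s)) := by
          apply Finset.prod_le_prod
          · intro i _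
            exact Finset.prod_nonneg fun j _ => Nat.cast_nonneg _
          · intro i _
            exact Finset.prod_le_prod (fun j _ => Nat.cast_nonneg _) fun j _ => hIcard j i
      _ = _ := by
          simp only [Finset.prod_mul_distrib, Finset.prod_const, Finset.card_univ,
            Fintype.card_fin]
          rw [← pow_mul, mul_comm ℓ d]
  have hBne : B.Nonempty := by
    refine ⟨fun _ _ => 1, ?_⟩
    simp only [B, I, Fintype.mem_piFinset, Finset.mem_Icc]
    intro j i
    have h1 : 0 ≤ M * max (v j i) 0 := mul_nonneg hM0 (le_max_right _ _)
    have h2 : 0 ≤ M * max (-(v j i)) 0 := mul_nonneg hM0 (le_max_right _ _)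
    constructor <;> linarith
  have hr : ∀ r ∈ Finset.Icc (1 : ℤ) M,
      A.card ^ ℓ ≤ (B.filter fun w => ∀ j, r • v j + w j ∈ A).card := by
    intro r hr
    rw [Finset.mem_Icc] at hr
    have : (Fintype.piFinset fun _ : Fin ℓ => A).card = A.card ^ ℓ := by
      simp
    rw [← this]
    apply Finset.card_le_card_of_injOn (fun a j => a j - r • v j)
    · intro a ha
      have ha' : ∀ j, a j ∈ A := by simpa using ha
      simp only [Finset.coe_filter, Set.mem_setOf_eq]
      refine ⟨?_, fun j => by simpa using ha' j⟩
      simp only [B, I, Fintype.mem_piFinset, Finset.mem_Icc]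
      intro j i
      have h := hA _ (ha' j) i
      rw [Finset.mem_Icc] at h
      simp only [Pi.sub_apply, Pi.smul_apply, smul_eq_mul]
      have p1 : r * v j i ≤ M * max (v j i) 0 :=
          (mul_le_mul_of_nonneg_left (le_max_left _ _) (by linarith)).trans
            (mul_le_mul_of_nonneg_right hr.2 (le_max_right _ _))
      have p2 : r * (-(v j i)) ≤ M * max (-(v j i)) 0 :=
        (mul_le_mul_of_nonneg_left (le_max_left _ _) (by linarith)).trans
          (mul_le_mul_of_nonneg_right hr.2 (le_max_right _ _))
      constructor <;> linarith
    · intro a _ b _ hab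
      funext j
      have := congrFun hab j
      simpa using this
  have hsum : ∑ w ∈ B, ((Finset.Icc (1 : ℤ) M).filter
      fun r => ∀ j : Fin ℓ, r • v j + w j ∈ A).card =
      ∑ r ∈ Finset.Icc (1 : ℤ) M, (B.filter fun w => ∀ j, r • v j + w j ∈ A).card := by
    simp only [Finset.card_filter]
    exact Finset.sum_comm
  have hlow : (A.card : ℝ) ^ ℓ * M ≤ ∑ w ∈ B, (((Finset.Icc (1 : ℤ) M).filter
      fun r => ∀ j : Fin ℓ, r • v j + w j ∈ A).card : ℝ) := by
    have h1 := Finset.card_nsmul_le_sum _ _ _ hr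
    rw [← hsum] at h1
    have h2 : ((Finset.Icc (1 : ℤ) M).card : ℤ) = M := by
      rw [Int.card_Icc, Int.toNat_of_nonneg] <;> linarith
    have h3 : ((Finset.Icc (1 : ℤ) M).card : ℝ) = M := by exact_mod_cast h2
    rw [← h3, mul_comm]
    rw [smul_eq_mul] at h1
    exact_mod_cast h1
  have hBpos : (0 : ℝ) < B.card := by exact_mod_cast hBne.card_pos
  have hDpos := lt_of_lt_of_le hBpos hBcard
  have hMR : (0 : ℝ) ≤ M := by exact_mod_cast hM0
  obtain ⟨w, _, hw⟩ := Finset.exists_le_of_sum_le (s := B)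
    (f := fun _ => (A.card : ℝ) ^ ℓ * M /
      ((N : ℝ) ^ (d * ℓ) * ∏ i : Fin d, ∏ j : Fin ℓ, (1 + |(v j i : ℝ)| / s)))
    (g := fun w => (((Finset.Icc (1 : ℤ) M).filter
      fun r => ∀ j : Fin ℓ, r • v j + w j ∈ A).card : ℝ)) hBne (by
        refine le_trans ?_ hlow
        rw [Finset.sum_const, nsmul_eq_mul, ← mul_div_assoc, div_le_iff₀ hDpos, mul_comm]
        exact mul_le_mul_of_nonneg_left hBcard (by positivity))
  refine ⟨w, ?_⟩
  convert hw
end
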